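/- For every natural number n ≥ 13 there exists a maxnil graph G with n vertices and m edges such that m < 25n/12 − 1/4. -/

import Mathlib

open SimpleGraph

/-- `H` is a minor of `G`: there is a family of nonempty, pairwise disjoint,
connected branch sets in `G`, one for each vertex of `H`, with an edge of `G`
between the branch sets of any two adjacent vertices of `H`. -/
def IsMinor {W V : Type} (H : SimpleGraph W) (G : SimpleGraph V) : Prop :=
  ∃ f : W → Set V,
    (∀ w, (f w).Nonempty) ∧
    (∀ w, (G.induce (f w)).Connected) ∧
    (Pairwise fun w₁ w₂ => Disjoint (f w₁) (f w₂)) ∧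
    ∀ ⦃w₁ w₂⦄, H.Adj w₁ w₂ → ∃ v₁ ∈ f w₁, ∃ v₂ ∈ f w₂, G.Adj v₁ v₂

/-- The result of a `∇Y`-move on the triangle `a b c` of `G`: delete the edges of
the triangle and add a new vertex (`none`) joined to `a`, `b`, `c`. -/
def triangleY {V : Type} (G : SimpleGraph V) (a b c : V) : SimpleGraph (Option V) :=
  (SimpleGraph.map Function.Embedding.some
      (G.deleteEdges {s(a, b), s(b, c), s(a, c)})) ⊔
    SimpleGraph.fromEdgeSet {s((none : Option V), some a), s(none, some b), s(none, some c)}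

/-- Membership in the Petersen family: the graphs obtained from `K₆` by
`∇Y`-moves and `Y∇`-moves (the inverse operation), up to isomorphism. -/
inductive IsPetersenFamily : ∀ {V : Type}, SimpleGraph V → Prop
  | k6 : IsPetersenFamily (⊤ : SimpleGraph (Fin 6))
  | deltaY {V : Type} {G : SimpleGraph V} {a b c : V} :
      IsPetersenFamily G → G.Adj a b → G.Adj b c → G.Adj a c →
      IsPetersenFamily (triangleY G a b c)
  | yDelta {V : Type} {G : SimpleGraph V} {a b c : V} :
      IsPetersenFamily (triangleY G a b c) → G.Adj a b → G.Adj b c → G.Adj a c →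
      IsPetersenFamily G
  | iso {V W : Type} {G : SimpleGraph V} {H : SimpleGraph W} :
      IsPetersenFamily G → G ≃g H → IsPetersenFamily H

/-- A graph is linklessly embeddable (nIL) iff it has no minor in the Petersen family. -/
def IsLinkless {V : Type} (G : SimpleGraph V) : Prop :=
  ∀ ⦃W : Type⦄ (P : SimpleGraph W), IsPetersenFamily P → ¬ IsMinor P G

/-- The graph obtained from `G` by adding the edge `ab`. -/
def addEdge {V : Type} (G : SimpleGraph V) (a b : V) : SimpleGraph V :=
  G ⊔ SimpleGraph.fromEdgeSet {s(a, b)}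

/-- A nIL graph is maxnil if adding any edge yields a graph that is not nIL. -/
def IsMaxnil {V : Type} (G : SimpleGraph V) : Prop :=
  IsLinkless G ∧ ∀ a b : V, a ≠ b → ¬ G.Adj a b → ¬ IsLinkless (addEdge G a b)

/-- `S` is a vertex cut set of the connected graph `G` if `G - S` is disconnected. -/
def IsVertexCut {V : Type} (G : SimpleGraph V) (S : Set V) : Prop :=
  G.Connected ∧ ¬ (G.induce Sᶜ).Preconnected

/-- A vertex cut set is minimal if no proper subset of it is a vertex cut set. -/
def IsMinimalVertexCut {V : Type} (G : SimpleGraph V) (S : Set V) : Prop :=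
  IsVertexCut G S ∧ ∀ S' ⊂ S, ¬ IsVertexCut G S'

/-- A set `T` of vertices of `H` (inducing a `K₄`) is strongly separating if `H - T`
has at least two connected components such that every vertex of `T` has a
neighbor in each of them. -/
def StronglySeparating {V : Type} (H : SimpleGraph V) (T : Set V) : Prop :=
  ∃ C₁ C₂ : (H.induce Tᶜ).ConnectedComponent, C₁ ≠ C₂ ∧
    ∀ v ∈ T, (∃ u ∈ C₁.supp, H.Adj v ↑u) ∧ (∃ u ∈ C₂.supp, H.Adj v ↑u)

/-- `G` is maximal without a `K₆` minor. -/
def IsMaximalK6MinorFree {V : Type} (G : SimpleGraph V) : Prop :=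
  ¬ IsMinor (⊤ : SimpleGraph (Fin 6)) G ∧
    ∀ a b : V, a ≠ b → ¬ G.Adj a b → IsMinor (⊤ : SimpleGraph (Fin 6)) (addEdge G a b)

/-! ### Chains of edges modulo two -/

/-- Sum of `f` over a list of (oriented) edges. -/
def bsum {A : Type} (L : List A) (f : A → ZMod 2) : ZMod 2 := (L.map f).sum

@[simp] theorem bsum_nil {A : Type} (f : A → ZMod 2) : bsum [] f = 0 := rfl

@[simp] theorem bsum_cons {A : Type} (a : A) (L : List A) (f : A → ZMod 2) :
    bsum (a :: L) f = f a + bsum L f := by simp [bsum]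

@[simp] theorem bsum_append {A : Type} (L M : List A) (f : A → ZMod 2) :
    bsum (L ++ M) f = bsum L f + bsum M f := by simp [bsum]

theorem bsum_add {A : Type} (L : List A) (f g : A → ZMod 2) :
    bsum L (fun a => f a + g a) = bsum L f + bsum L g := by
  induction L with
  | nil => simp
  | cons a L ih => simp only [bsum_cons, ih]; ring

@[simp] theorem bsum_zero {A : Type} (L : List A) : bsum L (fun _ => 0) = 0 := by
  induction L with
  | nil => simp
  | cons a L ih => simp [ih]

theorem bsum_mul {A : Type} (L : List A) (k : ZMod 2) (f : A → ZMod 2) :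
    bsum L (fun a => k * f a) = k * bsum L f := by
  induction L with
  | nil => simp
  | cons a L ih => simp only [bsum_cons, ih]; ring

theorem bsum_mul' {A : Type} (L : List A) (k : ZMod 2) (f : A → ZMod 2) :
    bsum L (fun a => f a * k) = bsum L f * k := by
  induction L with
  | nil => simp
  | cons a L ih => simp only [bsum_cons, ih]; ring

theorem bsum_congr {A : Type} {L : List A} {f g : A → ZMod 2} (h : ∀ a ∈ L, f a = g a) :
    bsum L f = bsum L g := by
  induction L with
  | nil => simp
  | cons a L ih =>
    simp only [bsum_cons]
    rw [h a (by simp), ih (fun b hb => h b (by simp [hb]))]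

theorem bsum_comm {A B : Type} (L : List A) (M : List B) (f : A → B → ZMod 2) :
    bsum L (fun a => bsum M (fun b => f a b)) = bsum M (fun b => bsum L (fun a => f a b)) := by
  induction L with
  | nil => simp
  | cons a L ih => simp only [bsum_cons, ih, bsum_add]

theorem bsum_flatMap {A B : Type} (L : List A) (φ : A → List B) (f : B → ZMod 2) :
    bsum (L.flatMap φ) f = bsum L (fun a => bsum (φ a) f) := by
  induction L with
  | nil => simp
  | cons a L ih => simp [List.flatMap_cons, ih]

theorem bsum_map {A B : Type} (L : List A) (φ : A → B) (f : B → ZMod 2) :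
    bsum (L.map φ) f = bsum L (fun a => f (φ a)) := by
  induction L with
  | nil => simp
  | cons a L ih => simp [ih]

theorem bsum_filter {A : Type} (L : List A) (P : A → Prop) [DecidablePred P] (f : A → ZMod 2) :
    bsum L f = bsum (L.filter (fun a => P a)) f + bsum (L.filter (fun a => ¬ P a)) f := by
  induction L with
  | nil => simp
  | cons a L ih =>
    by_cases h : P a
    · simp [h, ih]; ring
    · simp [h, ih]; ring

theorem z2_add_self (a : ZMod 2) : a + a = 0 := CharTwo.add_self_eq_zero a

theorem z2_eq_of_add {a b : ZMod 2} (h : a + b = 0) : a = b := CharTwo.add_eq_zero.mp h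

/-- A list of edges has zero boundary modulo two. -/
def ClosedL {V : Type} (L : List (V × V)) : Prop :=
  ∀ h : V → ZMod 2, bsum L (fun p => h p.1 + h p.2) = 0

def EdgesIn {V : Type} (G : SimpleGraph V) (L : List (V × V)) : Prop :=
  ∀ p ∈ L, G.Adj p.1 p.2

def DisjE {V : Type} (p q : V × V) : Prop :=
  p.1 ≠ q.1 ∧ p.1 ≠ q.2 ∧ p.2 ≠ q.1 ∧ p.2 ≠ q.2

def DisjL {V : Type} (L M : List (V × V)) : Prop := ∀ p ∈ L, ∀ q ∈ M, DisjE p q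

theorem DisjE.symm {V : Type} {p q : V × V} (h : DisjE p q) : DisjE q p :=
  ⟨h.1.symm, h.2.2.1.symm, h.2.1.symm, h.2.2.2.symm⟩

theorem DisjL.symm {V : Type} {L M : List (V × V)} (h : DisjL L M) : DisjL M L :=
  fun p hp q hq => (h q hq p hp).symm

/-- The linking number modulo two of two chains. -/
def lk {V : Type} (c : V × V → V × V → ZMod 2) (L M : List (V × V)) : ZMod 2 :=
  bsum L (fun p => bsum M (fun q => c p q))

def o4 {V : Type} (o : V → V → ZMod 2) (p q : V × V) : ZMod 2 :=
  o p.1 q.1 + o p.1 q.2 + o p.2 q.1 + o p.2 q.2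

/-- `c` is a system of (over/under) crossing parities with all linking numbers zero. -/
structure FlatWith {V : Type} (G : SimpleGraph V) (o : V → V → ZMod 2)
    (c : V × V → V × V → ZMod 2) : Prop where
  tour : ∀ x y, x ≠ y → o x y + o y x = 1
  sym : ∀ p q, G.Adj p.1 p.2 → G.Adj q.1 q.2 → DisjE p q → c p q + c q p = o4 o p q
  lk0 : ∀ L M, EdgesIn G L → EdgesIn G M → ClosedL L → ClosedL M → DisjL L M → lk c L M = 0

def Flat {V : Type} (G : SimpleGraph V) : Prop := ∃ o c, FlatWith G o c

theorem bsum_o4_right {V : Type} (o : V → V → ZMod 2) (p : V × V) (M : List (V × V))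
    (hM : ClosedL M) : bsum M (fun q => o4 o p q) = 0 := by
  rw [← hM (fun v => o p.1 v + o p.2 v)]
  apply bsum_congr
  intro q _
  simp only [o4]; ring

theorem lk_o4 {V : Type} (o : V → V → ZMod 2) (L M : List (V × V))
    (hM : ClosedL M) : lk (o4 o) L M = 0 := by
  simp only [lk, bsum_o4_right o _ M hM, bsum_zero]

theorem lk_add {V : Type} (c d : V × V → V × V → ZMod 2) (L M : List (V × V)) :
    lk (fun p q => c p q + d p q) L M = lk c L M + lk d L M := by
  simp only [lk, bsum_add]

theorem lk_congr {V : Type} {c d : V × V → V × V → ZMod 2} {L M : List (V × V)}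
    (h : ∀ p ∈ L, ∀ q ∈ M, c p q = d p q) : lk c L M = lk d L M :=
  bsum_congr fun p hp => bsum_congr fun q hq => h p hp q hq

theorem lk_swap {V : Type} (c : V × V → V × V → ZMod 2) (L M : List (V × V)) :
    lk (fun p q => c q p) L M = lk c M L := bsum_comm L M _

/-- Linking numbers are symmetric. -/
theorem lk_symm_of {V : Type} {G : SimpleGraph V} {o : V → V → ZMod 2}
    {c : V × V → V × V → ZMod 2}
    (sym : ∀ p q, G.Adj p.1 p.2 → G.Adj q.1 q.2 → DisjE p q → c p q + c q p = o4 o p q)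
    {L M : List (V × V)} (hL : EdgesIn G L) (hM : EdgesIn G M) (cM : ClosedL M)
    (hd : DisjL L M) : lk c L M = lk c M L := by
  apply z2_eq_of_add
  rw [← lk_swap c L M, ← lk_add, ← lk_o4 o L M cM]
  exact lk_congr fun p hp q hq => sym p q (hL p hp) (hM q hq) (hd p hp q hq)

/-- Flatness can be pulled back along a map sending edges to paths. -/
theorem Flat.transfer {V W : Type} {G : SimpleGraph V} {H : SimpleGraph W} (r : W → V)
    (hr : Function.Injective r) (φ : W × W → List (V × V))
    (h1 : ∀ e : W × W, H.Adj e.1 e.2 → EdgesIn G (φ e))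
    (h2 : ∀ e : W × W, H.Adj e.1 e.2 → ∀ h : V → ZMod 2,
      bsum (φ e) (fun p => h p.1 + h p.2) = h (r e.1) + h (r e.2))
    (h3 : ∀ e f : W × W, H.Adj e.1 e.2 → H.Adj f.1 f.2 → DisjE e f → DisjL (φ e) (φ f))
    (hG : Flat G) : Flat H := by
  obtain ⟨o, c, ht, hs, hl⟩ := hG
  refine ⟨fun u v => o (r u) (r v), fun e f => lk c (φ e) (φ f), ?_, ?_, ?_⟩
  · intro x y hxy
    exact ht _ _ (fun h => hxy (hr h))
  · intro e f he hf hd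
    rw [← lk_swap c (φ e) (φ f), ← lk_add]
    rw [lk_congr (d := o4 o) fun p hp q hq => hs p q (h1 e he p hp) (h1 f hf q hq)
      (h3 e f he hf hd p hp q hq)]
    have key : ∀ p : V × V, bsum (φ f) (fun q => o4 o p q)
        = (o p.1 (r f.1) + o p.1 (r f.2)) + (o p.2 (r f.1) + o p.2 (r f.2)) := by
      intro p
      have := h2 f hf (fun v => o p.1 v + o p.2 v)
      rw [show (o p.1 (r f.1) + o p.1 (r f.2)) + (o p.2 (r f.1) + o p.2 (r f.2)) =
        o p.1 (r f.1) + o p.2 (r f.1) + (o p.1 (r f.2) + o p.2 (r f.2)) by ring, ← this]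
      apply bsum_congr
      intro q _
      simp only [o4]; ring
    simp only [lk, key]
    rw [h2 e he (fun v => o v (r f.1) + o v (r f.2))]
    simp only [o4]; ring
  · intro L M hL hM cL cM hd
    have : lk (fun e f => lk c (φ e) (φ f)) L M = lk c (L.flatMap φ) (M.flatMap φ) := by
      simp only [lk, bsum_flatMap]
      apply bsum_congr
      intro e _
      rw [bsum_comm]
    rw [this]
    have cl : ∀ K : List (W × W), EdgesIn H K → ClosedL K → ClosedL (K.flatMap φ) := by
      intro K hK cK h
      rw [bsum_flatMap, ← cK (fun w => h (r w))]
      exact bsum_congr fun e he => h2 e (hK e he) h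
    apply hl
    · intro p hp
      obtain ⟨e, he, hp⟩ := List.mem_flatMap.mp hp
      exact h1 e (hL e he) p hp
    · intro p hp
      obtain ⟨e, he, hp⟩ := List.mem_flatMap.mp hp
      exact h1 e (hM e he) p hp
    · exact cl L hL cL
    · exact cl M hM cM
    · intro p hp q hq
      obtain ⟨e, he, hp⟩ := List.mem_flatMap.mp hp
      obtain ⟨f, hf, hq⟩ := List.mem_flatMap.mp hq
      exact h3 e f (hL e he) (hM f hf) (hd e he f hf) p hp q hq

/-- Any tournament may be prescribed. -/
theorem Flat.with {V : Type} {G : SimpleGraph V} (hG : Flat G) (o' : V → V → ZMod 2)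
    (ho' : ∀ x y, x ≠ y → o' x y + o' y x = 1) : ∃ c, FlatWith G o' c := by
  classical
  obtain ⟨o, c, ht, hs, hl⟩ := hG
  obtain ⟨s, hs1⟩ : ∃ s : V → V → Prop, ∀ x y, x ≠ y → (s x y ↔ ¬ s y x) :=
    ⟨fun x y => WellOrderingRel x y, fun x y hxy => by
      constructor
      · exact fun h h' => asymm h h'
      · intro h
        rcases trichotomous_of WellOrderingRel x y with h1 | h1 | h1
        · exact h1
        · exact absurd h1 hxy
        · exact absurd h1 h⟩
  let k : V → V → ZMod 2 := fun x y => if s x y then o x y + o' x y else 0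
  have hk : ∀ x y, x ≠ y → k x y + k y x = o x y + o' x y := by
    intro x y hxy
    have h1 := hs1 x y hxy
    have e1 := ht x y hxy
    have e2 := ho' x y hxy
    by_cases h : s x y
    · simp [k, h, h1.mp h]
    · have h' : s y x := by by_contra h'; exact h (h1.mpr h')
      simp only [k, h, h', if_true, if_false, zero_add]
      generalize o x y = a, o y x = b, o' x y = c, o' y x = d at *
      revert a b c d; decide
  refine ⟨fun p q => c p q + o4 k p q, ho', ?_, ?_⟩
  · intro p q hp hq hd
    have h0 := hs p q hp hq hd
    have a1 := hk _ _ hd.1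
    have a2 := hk _ _ hd.2.1
    have a3 := hk _ _ hd.2.2.1
    have a4 := hk _ _ hd.2.2.2
    have two : (2 : ZMod 2) = 0 := rfl
    simp only [o4] at *
    linear_combination h0 + a1 + a2 + a3 + a4 + (o p.1 q.1 + o p.1 q.2 + o p.2 q.1 + o p.2 q.2) * two
  · intro L M hL hM cL cM hd
    rw [lk_add, hl L M hL hM cL cM hd, lk_o4 k L M cM, add_zero]

theorem path_list {V : Type} {G : SimpleGraph V} {S : Set V} (hS : (G.induce S).Preconnected)
    {a b : V} (ha : a ∈ S) (hb : b ∈ S) :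
    ∃ L : List (V × V), EdgesIn G L ∧ (∀ p ∈ L, p.1 ∈ S ∧ p.2 ∈ S) ∧
      ∀ h : V → ZMod 2, bsum L (fun p => h p.1 + h p.2) = h a + h b := by
  obtain ⟨w⟩ := hS ⟨a, ha⟩ ⟨b, hb⟩
  suffices H : ∀ (x y : S) (w : (G.induce S).Walk x y),
      ∃ L : List (V × V), EdgesIn G L ∧ (∀ p ∈ L, p.1 ∈ S ∧ p.2 ∈ S) ∧
      ∀ h : V → ZMod 2, bsum L (fun p => h p.1 + h p.2) = h x + h y from H _ _ w
  intro x y w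
  induction w with
  | nil => exact ⟨[], by simp [EdgesIn], by simp, fun h => by simp [z2_add_self]⟩
  | @cons u v w huv p ih =>
    obtain ⟨L, h1, h2, h3⟩ := ih
    refine ⟨((u : V), (v : V)) :: L, ?_, ?_, ?_⟩
    · intro p hp
      rcases List.mem_cons.mp hp with rfl | hp
      · exact huv
      · exact h1 p hp
    · intro p hp
      rcases List.mem_cons.mp hp with rfl | hp
      · exact ⟨u.2, v.2⟩
      · exact h2 p hp
    · intro h
      rw [bsum_cons, h3]
      simp only
      linear_combination z2_add_self (h v)

theorem Flat.minor {V W : Type} {G : SimpleGraph V} {H : SimpleGraph W} (hm : IsMinor H G)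
    (hG : Flat G) : Flat H := by
  obtain ⟨f, hne, hc, hd, ha⟩ := hm
  choose r hr using hne
  have hdis : ∀ u v x, x ∈ f u → x ∈ f v → u = v := by
    intro u v x hu hv
    by_contra huv
    exact Set.disjoint_left.mp (hd huv) hu hv
  have : ∀ e : W × W, ∃ L : List (V × V), H.Adj e.1 e.2 → (EdgesIn G L ∧
      (∀ p ∈ L, (p.1 ∈ f e.1 ∨ p.1 ∈ f e.2) ∧ (p.2 ∈ f e.1 ∨ p.2 ∈ f e.2)) ∧
      ∀ h : V → ZMod 2, bsum L (fun p => h p.1 + h p.2) = h (r e.1) + h (r e.2)) := by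
    intro e
    by_cases he : H.Adj e.1 e.2
    · obtain ⟨x, hx, y, hy, hxy⟩ := ha he
      obtain ⟨L, a1, a2, a3⟩ := path_list (hc e.1).preconnected (hr e.1) hx
      obtain ⟨M, b1, b2, b3⟩ := path_list (hc e.2).preconnected (hr e.2) hy
      refine ⟨L ++ (x, y) :: M, fun _ => ⟨?_, ?_, ?_⟩⟩
      · intro p hp
        rcases List.mem_append.mp hp with hp | hp
        · exact a1 p hp
        rcases List.mem_cons.mp hp with rfl | hp
        · exact hxy
        · exact b1 p hp
      · intro p hp
        rcases List.mem_append.mp hp with hp | hp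
        · exact ⟨Or.inl (a2 p hp).1, Or.inl (a2 p hp).2⟩
        rcases List.mem_cons.mp hp with rfl | hp
        · exact ⟨Or.inl hx, Or.inr hy⟩
        · exact ⟨Or.inr (b2 p hp).1, Or.inr (b2 p hp).2⟩
      · intro h
        rw [bsum_append, bsum_cons, a3, b3]
        simp only
        linear_combination z2_add_self (h x) + z2_add_self (h y)
    · exact ⟨[], fun h => absurd h he⟩
  choose φ hφ using this
  refine hG.transfer r ?_ φ (fun e he => (hφ e he).1) (fun e he => (hφ e he).2.2) ?_
  · intro u v huv
    exact hdis u v (r u) (hr u) (huv ▸ hr v)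
  · intro e g he hg hdisj p hp q hq
    have a := (hφ e he).2.1 p hp
    have b := (hφ g hg).2.1 q hq
    have key : ∀ x y, (x ∈ f e.1 ∨ x ∈ f e.2) → (y ∈ f g.1 ∨ y ∈ f g.2) → x ≠ y := by
      rintro x y hx hy rfl
      rcases hx with hx | hx <;> rcases hy with hy | hy
      · exact hdisj.1 (hdis _ _ _ hx hy)
      · exact hdisj.2.1 (hdis _ _ _ hx hy)
      · exact hdisj.2.2.1 (hdis _ _ _ hx hy)
      · exact hdisj.2.2.2 (hdis _ _ _ hx hy)
    exact ⟨key _ _ a.1 b.1, key _ _ a.1 b.2, key _ _ a.2 b.1, key _ _ a.2 b.2⟩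

/-- Flatness only depends on the isomorphism type. -/
theorem Flat.iso {V W : Type} {G : SimpleGraph V} {H : SimpleGraph W} (e : G ≃g H)
    (hG : Flat G) : Flat H := by
  refine hG.transfer e.symm e.symm.injective (fun p => [(e.symm p.1, e.symm p.2)]) ?_ ?_ ?_
  · intro p hp q hq
    rw [List.mem_singleton] at hq
    subst hq
    exact e.symm.map_adj_iff.mpr hp
  · intro p hp h
    simp
  · intro p q hp hq hd a ha b hb
    rw [List.mem_singleton] at ha hb
    subst ha hb
    have inj := e.symm.injective
    exact ⟨fun h => hd.1 (inj h), fun h => hd.2.1 (inj h), fun h => hd.2.2.1 (inj h),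
      fun h => hd.2.2.2 (inj h)⟩

/-- A triangle as a closed chain. -/
theorem closed_tri {V : Type} (a b c : V) : ClosedL [(a, b), (b, c), (a, c)] := by
  intro h
  simp only [bsum_cons, bsum_nil]
  generalize h a = x, h b = y, h c = z
  revert x y z; decide

theorem not_flat_k6 : ¬ Flat (⊤ : SimpleGraph (Fin 6)) := by
  rintro ⟨o, c, ht, hs, hl⟩
  have tri : ∀ i j k l m n : Fin 6, [i, j, k, l, m, n].Nodup →
      lk c [(i, j), (j, k), (i, k)] [(l, m), (m, n), (l, n)] = 0 := by
    intro i j k l m n hn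
    simp only [List.nodup_cons, List.mem_cons, List.not_mem_nil, or_false, not_or,
      List.nodup_nil, not_false_eq_true, and_true] at hn
    obtain ⟨⟨h1, h2, h3, h4, h5⟩, ⟨h6, h7, h8, h9⟩, ⟨h10, h11, h12⟩, ⟨h13, h14⟩, h15⟩ := hn
    apply hl
    · intro p hp
      simp only [List.mem_cons, List.not_mem_nil, or_false] at hp
      rcases hp with rfl | rfl | rfl <;> simp_all
    · intro p hp
      simp only [List.mem_cons, List.not_mem_nil, or_false] at hp
      rcases hp with rfl | rfl | rfl <;> simp_all
    · exact closed_tri _ _ _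
    · exact closed_tri _ _ _
    · intro p hp q hq
      simp only [List.mem_cons, List.not_mem_nil, or_false] at hp hq
      rcases hp with rfl | rfl | rfl <;> rcases hq with rfl | rfl | rfl <;>
        refine ⟨?_, ?_, ?_, ?_⟩ <;> assumption
  have four : ∀ i j k l : Fin 6, i < j → j < k → k < l →
      (c (i, j) (k, l) + c (k, l) (i, j)) + (c (i, k) (j, l) + c (j, l) (i, k))
        + (c (i, l) (j, k) + c (j, k) (i, l)) = 1 := by
    intro i j k l h1 h2 h3
    have n1 : i ≠ j := h1.ne
    have n2 : j ≠ k := h2.ne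
    have n3 : k ≠ l := h3.ne
    have n4 : i ≠ k := (h1.trans h2).ne
    have n5 : j ≠ l := (h2.trans h3).ne
    have n6 : i ≠ l := (h1.trans (h2.trans h3)).ne
    rw [hs (i, j) (k, l) n1 n3 ⟨n4, n6, n2, n5⟩,
      hs (i, k) (j, l) n4 n5 ⟨n1, n6, n2.symm, n3⟩,
      hs (i, l) (j, k) n6 n2 ⟨n1, n4, n5.symm, n3.symm⟩]
    have e1 := ht j k n2
    have e2 := ht j l n5
    have e3 := ht k l n3
    simp only [o4]
    have two : (2 : ZMod 2) = 0 := rfl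
    linear_combination e1 + e2 + e3 + (o i j + o i k + o i l + 1) * two
  have t1 := tri 0 1 2 3 4 5 (by decide)
  have t2 := tri 0 1 3 2 4 5 (by decide)
  have t3 := tri 0 1 4 2 3 5 (by decide)
  have t4 := tri 0 1 5 2 3 4 (by decide)
  have t5 := tri 0 2 3 1 4 5 (by decide)
  have t6 := tri 0 2 4 1 3 5 (by decide)
  have t7 := tri 0 2 5 1 3 4 (by decide)
  have t8 := tri 0 3 4 1 2 5 (by decide)
  have t9 := tri 0 3 5 1 2 4 (by decide)
  have t10 := tri 0 4 5 1 2 3 (by decide)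
  have f1 := four 1 2 3 4 (by decide) (by decide) (by decide)
  have f2 := four 1 2 3 5 (by decide) (by decide) (by decide)
  have f3 := four 1 2 4 5 (by decide) (by decide) (by decide)
  have f4 := four 1 3 4 5 (by decide) (by decide) (by decide)
  have f5 := four 2 3 4 5 (by decide) (by decide) (by decide)
  simp only [lk, bsum_cons, bsum_nil, add_zero] at t1 t2 t3 t4 t5 t6 t7 t8 t9 t10
  have : (0 : ZMod 2) = 1 := by
    grind
  exact absurd this (by decide)

/-! ### Gradients and triangle-star exchanges -/

theorem reach_list {V : Type} {G : SimpleGraph V} {a b : V} (hab : G.Reachable a b) :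
    ∃ L : List (V × V), EdgesIn G L ∧
      ∀ h : V → ZMod 2, bsum L (fun p => h p.1 + h p.2) = h a + h b := by
  obtain ⟨w⟩ := hab
  induction w with
  | nil => exact ⟨[], by simp [EdgesIn], fun h => by simp [z2_add_self]⟩
  | @cons u v w huv p ih =>
    obtain ⟨L, h1, h3⟩ := ih
    refine ⟨(u, v) :: L, ?_, ?_⟩
    · intro p hp
      rcases List.mem_cons.mp hp with rfl | hp
      · exact huv
      · exact h1 p hp
    · intro h
      rw [bsum_cons, h3]
      simp only
      linear_combination z2_add_self (h v)

/-- A function on edges that vanishes on all closed chains is a gradient. -/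
theorem exists_potential {V : Type} (G : SimpleGraph V) (A : V → Prop) (t : V × V → ZMod 2)
    (H : ∀ L, EdgesIn G L → (∀ p ∈ L, A p.1 ∧ A p.2) → ClosedL L → bsum L t = 0) :
    ∃ h : V → ZMod 2, ∀ u v, G.Adj u v → A u → A v → t (u, v) = h u + h v := by
  let G' : SimpleGraph V :=
    { Adj := fun u v => G.Adj u v ∧ A u ∧ A v
      symm := ⟨fun u v h => ⟨h.1.symm, h.2.2, h.2.1⟩⟩
      loopless := ⟨fun u h => G.loopless.irrefl u h.1⟩ }
  let r : V → V := fun v => (G'.connectedComponentMk v).out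
  have hr : ∀ v, G'.Reachable (r v) v := fun v =>
    SimpleGraph.ConnectedComponent.exact (Quot.out_eq (G'.connectedComponentMk v))
  choose L h1 h2 using fun v => reach_list (hr v)
  refine ⟨fun v => bsum (L v) t, fun u v huv hu hv => ?_⟩
  have huv' : G'.Adj u v := ⟨huv, hu, hv⟩
  have hrr : r u = r v := by
    have : G'.connectedComponentMk u = G'.connectedComponentMk v :=
      SimpleGraph.ConnectedComponent.sound huv'.reachable
    simp only [r, this]
  have e := H ((u, v) :: (L u ++ L v)) (by
      intro p hp
      rcases List.mem_cons.mp hp with rfl | hp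
      · exact huv
      rcases List.mem_append.mp hp with hp | hp
      · exact (h1 u p hp).1
      · exact (h1 v p hp).1) (by
      intro p hp
      rcases List.mem_cons.mp hp with rfl | hp
      · exact ⟨hu, hv⟩
      rcases List.mem_append.mp hp with hp | hp
      · exact (h1 u p hp).2
      · exact (h1 v p hp).2) (by
      intro h
      rw [bsum_cons, bsum_append, h2, h2, hrr]
      simp only
      linear_combination z2_add_self (h u) + z2_add_self (h v) + z2_add_self (h (r v)))
  rw [bsum_cons, bsum_append] at e
  exact z2_eq_of_add e

theorem triangleY_some {V : Type} {G : SimpleGraph V} {a b c u v : V} :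
    (triangleY G a b c).Adj (some u) (some v) ↔
      G.Adj u v ∧ s(u, v) ∉ ({s(a, b), s(b, c), s(a, c)} : Set (Sym2 V)) := by
  rw [triangleY, SimpleGraph.sup_adj, SimpleGraph.map_adj]
  simp [and_assoc]

theorem triangleY_none {V : Type} {G : SimpleGraph V} {a b c v : V} :
    (triangleY G a b c).Adj none (some v) ↔ v = a ∨ v = b ∨ v = c := by
  rw [triangleY, SimpleGraph.sup_adj, SimpleGraph.map_adj]
  simp

theorem triangleY_none' {V : Type} {G : SimpleGraph V} {a b c v : V} :
    (triangleY G a b c).Adj (some v) none ↔ v = a ∨ v = b ∨ v = c := by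
  rw [SimpleGraph.adj_comm, triangleY_none]

theorem Flat.of_triangleY {V : Type} {G : SimpleGraph V} {a b c : V}
    (h : Flat (triangleY G a b c)) : Flat G := by
  classical
  refine h.transfer some (Option.some_injective V)
    (fun e => if (e.1 = a ∨ e.1 = b ∨ e.1 = c) ∧ (e.2 = a ∨ e.2 = b ∨ e.2 = c) then
      [(some e.1, none), (none, some e.2)] else [(some e.1, some e.2)]) ?_ ?_ ?_
  · rintro ⟨u, v⟩ huv
    dsimp only at huv ⊢
    split_ifs with hc
    · intro p hp
      simp only [List.mem_cons, List.not_mem_nil, or_false] at hp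
      rcases hp with rfl | rfl
      · exact triangleY_none'.mpr hc.1
      · exact triangleY_none.mpr hc.2
    · intro p hp
      rw [List.mem_singleton] at hp
      subst hp
      refine triangleY_some.mpr ⟨huv, ?_⟩
      intro hm
      apply hc
      simp only [Set.mem_insert_iff, Set.mem_singleton_iff, Sym2.eq_iff] at hm
      grind
  · rintro ⟨u, v⟩ huv k
    dsimp only at huv ⊢
    split_ifs with hc
    · simp only [bsum_cons, bsum_nil]
      linear_combination z2_add_self (k none)
    · simp
  · rintro ⟨u, v⟩ ⟨s, t⟩ huv hst hd p hp q hq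
    obtain ⟨d1, d2, d3, d4⟩ := hd
    have n1 := huv.ne
    have n2 := hst.ne
    dsimp only at *
    split_ifs at hp hq with h1 h2 h3 <;>
    simp only [List.mem_cons, List.not_mem_nil, or_false] at hp hq
    · grind
    · rcases hp with rfl | rfl <;> subst hq <;> simp [DisjE, *]
    · rcases hq with rfl | rfl <;> subst hp <;> simp [DisjE, *]
    · subst hp hq; simp [DisjE, *]

theorem bsum_ne {A : Type} {L : List A} {f : A → ZMod 2} (h : bsum L f ≠ 0) :
    ∃ p ∈ L, f p ≠ 0 := by
  by_contra hc
  push Not at hc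
  exact h ((bsum_congr hc).trans (bsum_zero L))

section deltaY
variable {V : Type}

/-- the tournament on `Option V` -/
def optO (o : V → V → ZMod 2) : Option V → Option V → ZMod 2
  | some u, some v => o u v
  | none, some _ => 1
  | _, _ => 0

def optC (o : V → V → ZMod 2) (cr : V × V → V × V → ZMod 2) (g : V × V → V → ZMod 2) :
    Option V × Option V → Option V × Option V → ZMod 2
  | (some u, some v), (some s, some t) => cr (u, v) (s, t)
  | (none, some x), (some s, some t) => g (s, t) x
  | (some x, none), (some s, some t) => g (s, t) x
  | (some u, some v), (none, some x) => g (u, v) x + o4 (optO o) (some u, some v) (none, some x)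
  | (some u, some v), (some x, none) => g (u, v) x + o4 (optO o) (some u, some v) (some x, none)
  | _, _ => 0

def optPsi : Option V × Option V → List (V × V)
  | (some u, some v) => [(u, v)]
  | _ => []

open Classical in
noncomputable def optSt (x : V) : Option V × Option V → ZMod 2
  | (none, some y) => if y = x then 1 else 0
  | (some y, none) => if y = x then 1 else 0
  | _ => 0

theorem choose_g {V : Type} (a b c : V) (cr : V × V → V × V → ZMod 2) (D : V × V → ZMod 2)
    (hab : a ≠ b) (hbc : b ≠ c) (hac : a ≠ c)
    (q : V × V) (hq : DisjE (a, b) q → DisjE (b, c) q →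
      cr (a, b) q + cr (b, c) q + cr (a, c) q = D q) :
    ∃ g : V → ZMod 2, (DisjE (a, b) q → g a + g b = cr (a, b) q + D q) ∧
      (DisjE (b, c) q → g b + g c = cr (b, c) q + D q) ∧
      (DisjE (a, c) q → g a + g c = cr (a, c) q + D q) := by
  classical
  have mk : ∀ x y z : ZMod 2, ∃ g : V → ZMod 2, g a = x ∧ g b = y ∧ g c = z := fun x y z =>
    ⟨fun v => if v = a then x else if v = b then y else z, by simp, by simp [hab.symm],
      by simp [hac.symm, hbc.symm]⟩
  by_cases h1 : DisjE (a, b) q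
  · by_cases h2 : DisjE (b, c) q
    · obtain ⟨g, ga, gb, gc⟩ := mk (cr (a, b) q + D q) 0 (cr (b, c) q + D q)
      refine ⟨g, fun _ => ?_, fun _ => ?_, fun _ => ?_⟩
      · rw [ga, gb]; ring
      · rw [gb, gc]; ring
      · rw [ga, gc]
        linear_combination hq h1 h2 + z2_add_self (D q) - z2_add_self (cr (a, c) q)
    · obtain ⟨g, ga, gb, gc⟩ := mk (cr (a, b) q + D q) 0 0
      refine ⟨g, fun _ => ?_, fun h => absurd h h2, fun h => ?_⟩
      · rw [ga, gb]; ring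
      · exact absurd ⟨h1.2.2.1, h1.2.2.2, h.2.2.1, h.2.2.2⟩ h2
  · by_cases h2 : DisjE (b, c) q
    · obtain ⟨g, ga, gb, gc⟩ := mk 0 (cr (b, c) q + D q) 0
      refine ⟨g, fun h => absurd h h1, fun _ => ?_, fun h => ?_⟩
      · rw [gb, gc]; ring
      · exact absurd ⟨h.1, h.2.1, h2.1, h2.2.1⟩ h1
    · obtain ⟨g, ga, gb, gc⟩ := mk (cr (a, c) q + D q) 0 0
      refine ⟨g, fun h => absurd h h1, fun h => absurd h h2, fun h => ?_⟩
      rw [ga, gc]; ring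

/-- The main linking number computation for a triangle-star exchange. -/
theorem optC_lk {G : SimpleGraph V} {a b c : V} (hab : G.Adj a b) (hbc : G.Adj b c)
    (hac : G.Adj a c) {o : V → V → ZMod 2} {cr : V × V → V × V → ZMod 2}
    (hl : ∀ L M, EdgesIn G L → EdgesIn G M → ClosedL L → ClosedL M → DisjL L M → lk cr L M = 0)
    {h : V → ZMod 2} {g : V × V → V → ZMod 2}
    (g1 : ∀ q, G.Adj q.1 q.2 → DisjE (a, b) q →
      g q a + g q b = cr (a, b) q + (h q.1 + h q.2))
    (g2 : ∀ q, G.Adj q.1 q.2 → DisjE (b, c) q →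
      g q b + g q c = cr (b, c) q + (h q.1 + h q.2))
    (g3 : ∀ q, G.Adj q.1 q.2 → DisjE (a, c) q →
      g q a + g q c = cr (a, c) q + (h q.1 + h q.2))
    (L : List (Option V × Option V)) (hL : EdgesIn (triangleY G a b c) L) (cL : ClosedL L)
    (M : List (V × V)) (hM : EdgesIn G M) (cM : ClosedL M)
    (hd : DisjL L (M.map (fun q => (some q.1, some q.2)))) :
    lk (optC o cr g) L (M.map (fun q => (some q.1, some q.2))) = 0 := by
  have nab := hab.ne
  have nbc := hbc.ne
  have nac := hac.ne
  set F : V → ZMod 2 := fun x => bsum M (fun q => g q x) with hF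
  set L1 := L.flatMap optPsi with hL1
  have key : lk (optC o cr g) L (M.map (fun q => (some q.1, some q.2)))
      = lk cr L1 M + bsum L (optSt a) * F a + bsum L (optSt b) * F b
        + bsum L (optSt c) * F c := by
    rw [lk, lk, hL1, bsum_flatMap, ← bsum_mul', ← bsum_mul', ← bsum_mul', ← bsum_add,
      ← bsum_add, ← bsum_add]
    apply bsum_congr
    rintro ⟨p1, p2⟩ hp
    have hp := hL _ hp
    rw [bsum_map]
    cases p1 with
    | none =>
      cases p2 with
      | none => exact absurd hp (SimpleGraph.irrefl _)
      | some x =>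
        rcases triangleY_none.mp hp with rfl | rfl | rfl <;>
          simp [optC, optPsi, optSt, hF, nab, nbc, nac, nab.symm, nbc.symm, nac.symm]
    | some x =>
      cases p2 with
      | none =>
        rcases triangleY_none'.mp hp with rfl | rfl | rfl <;>
          simp [optC, optPsi, optSt, hF, nab, nbc, nac, nab.symm, nbc.symm, nac.symm]
      | some y => simp [optC, optPsi, optSt]
  have bd : ∀ k : V → ZMod 2, bsum L1 (fun p => k p.1 + k p.2) + bsum L (optSt a) * k a
      + bsum L (optSt b) * k b + bsum L (optSt c) * k c = 0 := by
    intro k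
    rw [← cL (fun x => x.elim 0 k), hL1, bsum_flatMap, ← bsum_mul', ← bsum_mul', ← bsum_mul',
      ← bsum_add, ← bsum_add, ← bsum_add]
    apply bsum_congr
    rintro ⟨p1, p2⟩ hp
    have hp := hL _ hp
    cases p1 with
    | none =>
      cases p2 with
      | none => exact absurd hp (SimpleGraph.irrefl _)
      | some x =>
        rcases triangleY_none.mp hp with rfl | rfl | rfl <;>
          simp [optPsi, optSt, nab, nbc, nac, nab.symm, nbc.symm, nac.symm]
    | some x =>
      cases p2 with
      | none =>
        rcases triangleY_none'.mp hp with rfl | rfl | rfl <;>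
          simp [optPsi, optSt, nab, nbc, nac, nab.symm, nbc.symm, nac.symm]
      | some y => simp [optPsi, optSt]
  have bn : bsum L (optSt a) + bsum L (optSt b) + bsum L (optSt c) = 0 := by
    rw [← cL (fun x => x.elim 1 (fun _ => 0)), ← bsum_add, ← bsum_add]
    apply bsum_congr
    rintro ⟨p1, p2⟩ hp
    have hp := hL _ hp
    cases p1 with
    | none =>
      cases p2 with
      | none => exact absurd hp (SimpleGraph.irrefl _)
      | some x =>
        rcases triangleY_none.mp hp with rfl | rfl | rfl <;>
          simp [optSt, nab, nbc, nac, nab.symm, nbc.symm, nac.symm]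
    | some x =>
      cases p2 with
      | none =>
        rcases triangleY_none'.mp hp with rfl | rfl | rfl <;>
          simp [optSt, nab, nbc, nac, nab.symm, nbc.symm, nac.symm]
      | some y => simp [optSt]
  have eL1 : EdgesIn G L1 := by
    rintro ⟨u, v⟩ hp
    obtain ⟨⟨p1, p2⟩, he, hp⟩ := List.mem_flatMap.mp hp
    have he := hL _ he
    cases p1 <;> cases p2 <;> simp [optPsi] at hp
    obtain ⟨rfl, rfl⟩ := hp
    exact (triangleY_some.mp he).1
  have dL1 : DisjL L1 M := by
    rintro ⟨u, v⟩ hp q hq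
    obtain ⟨⟨p1, p2⟩, he, hp⟩ := List.mem_flatMap.mp hp
    have := hd _ he (some q.1, some q.2) (List.mem_map.mpr ⟨q, hq, rfl⟩)
    cases p1 <;> cases p2 <;> simp [optPsi] at hp
    obtain ⟨rfl, rfl⟩ := hp
    simpa [DisjE] using this
  have av : ∀ x, bsum L (optSt x) ≠ 0 → ∀ q ∈ M, x ≠ q.1 ∧ x ≠ q.2 := by
    intro x hx q hq
    obtain ⟨⟨p1, p2⟩, he, hp⟩ := bsum_ne hx
    have := hd _ he (some q.1, some q.2) (List.mem_map.mpr ⟨q, hq, rfl⟩)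
    cases p1 <;> cases p2 <;> simp [optSt] at hp <;> subst hp <;> simp [DisjE] at this <;>
      exact this
  have main : ∀ x y, G.Adj x y →
      (∀ q, G.Adj q.1 q.2 → DisjE (x, y) q → g q x + g q y = cr (x, y) q + (h q.1 + h q.2)) →
      bsum L (optSt x) ≠ 0 → bsum L (optSt y) ≠ 0 →
      (∀ k : V → ZMod 2, bsum L1 (fun p => k p.1 + k p.2) + k x + k y = 0) →
      lk cr L1 M + F x + F y = 0 := by
    intro x y hxy hg hx hy hk
    have dxy : ∀ q ∈ M, DisjE (x, y) q := fun q hq =>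
      ⟨(av x hx q hq).1, (av x hx q hq).2, (av y hy q hq).1, (av y hy q hq).2⟩
    have e1 := hl ((x, y) :: L1) M (by
      intro p hp
      rcases List.mem_cons.mp hp with rfl | hp
      · exact hxy
      · exact eL1 p hp) hM (by
      intro k
      rw [bsum_cons, ← hk k]
      simp only
      ring) cM (by
      intro p hp
      rcases List.mem_cons.mp hp with rfl | hp
      · exact dxy
      · exact dL1 p hp)
    rw [lk, bsum_cons] at e1
    have e2 : F x + F y = bsum M (fun q => cr (x, y) q) := by
      have := cM h
      rw [hF, ← bsum_add, ← add_zero (bsum M (fun q => cr (x, y) q)), ← this, ← bsum_add]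
      exact bsum_congr fun q hq => hg q (hM q hq) (dxy q hq)
    rw [add_assoc, e2, add_comm]
    exact e1
  rw [key]
  generalize eα : bsum L (optSt a) = α at *
  generalize eβ : bsum L (optSt b) = β at *
  generalize eγ : bsum L (optSt c) = γ at *
  have z2 : ∀ z : ZMod 2, z = 0 ∨ z = 1 := by decide
  rcases z2 α with rfl | rfl <;> rcases z2 β with rfl | rfl <;> rcases z2 γ with rfl | rfl <;>
    first
    | exact absurd bn (by decide)
    | skip
  · have := hl L1 M eL1 hM (fun k => by simpa using bd k) cM dL1
    simp [this]
  · have := main b c hbc g2 (by rw [eβ]; decide) (by rw [eγ]; decide)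
      (fun k => by simpa using bd k)
    simpa using this
  · have := main a c hac g3 (by rw [eα]; decide) (by rw [eγ]; decide)
      (fun k => by simpa using bd k)
    simpa using this
  · have := main a b hab g1 (by rw [eα]; decide) (by rw [eβ]; decide)
      (fun k => by simpa using bd k)
    simpa using this

theorem map_some_of {L : List (Option V × Option V)} (h : ∀ p ∈ L, p.1 ≠ none ∧ p.2 ≠ none) :
    ∃ M : List (V × V), L = M.map (fun q => (some q.1, some q.2)) := by
  induction L with
  | nil => exact ⟨[], rfl⟩
  | cons p L ih =>
    obtain ⟨M, rfl⟩ := ih fun q hq => h q (by simp [hq])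
    obtain ⟨h1, h2⟩ := h p (by simp)
    obtain ⟨p1, p2⟩ := p
    obtain ⟨u, rfl⟩ := Option.ne_none_iff_exists'.mp h1
    obtain ⟨v, rfl⟩ := Option.ne_none_iff_exists'.mp h2
    exact ⟨(u, v) :: M, by simp⟩

theorem Flat.triangleY {G : SimpleGraph V} {a b c : V} (hab : G.Adj a b) (hbc : G.Adj b c)
    (hac : G.Adj a c) (hG : Flat G) : Flat (triangleY G a b c) := by
  obtain ⟨o, cr, ht, hs, hl⟩ := hG
  have nab := hab.ne
  have nbc := hbc.ne
  have nac := hac.ne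
  obtain ⟨h, hh⟩ := exists_potential G (fun v => v ≠ a ∧ v ≠ b ∧ v ≠ c)
    (fun q => cr (a, b) q + cr (b, c) q + cr (a, c) q) (by
      intro L hL hA cL
      have e := hl [(a, b), (b, c), (a, c)] L (by
        intro p hp
        simp only [List.mem_cons, List.not_mem_nil, or_false] at hp
        rcases hp with rfl | rfl | rfl <;> assumption) hL (closed_tri a b c) cL (by
        intro p hp q hq
        obtain ⟨⟨a1, a2, a3⟩, a4, a5, a6⟩ := hA q hq
        simp only [List.mem_cons, List.not_mem_nil, or_false] at hp
        rcases hp with rfl | rfl | rfl <;> refine ⟨?_, ?_, ?_, ?_⟩ <;>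
          apply Ne.symm <;> assumption)
      rw [← e]
      simp only [lk, bsum_cons, bsum_nil, bsum_add]
      ring)
  have gex : ∀ q : V × V, ∃ g : V → ZMod 2, G.Adj q.1 q.2 →
      ((DisjE (a, b) q → g a + g b = cr (a, b) q + (h q.1 + h q.2)) ∧
      (DisjE (b, c) q → g b + g c = cr (b, c) q + (h q.1 + h q.2)) ∧
      (DisjE (a, c) q → g a + g c = cr (a, c) q + (h q.1 + h q.2))) := by
    intro q
    by_cases hq : G.Adj q.1 q.2
    · obtain ⟨g, hg⟩ := choose_g a b c cr (fun q => h q.1 + h q.2) nab nbc nac q (by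
        intro d1 d2
        exact hh q.1 q.2 hq ⟨d1.1.symm, d1.2.2.1.symm, d2.2.2.1.symm⟩
          ⟨d1.2.1.symm, d1.2.2.2.symm, d2.2.2.2.symm⟩)
      exact ⟨g, fun _ => hg⟩
    · exact ⟨0, fun h => absurd h hq⟩
  choose g hg using gex
  have sym : ∀ p q, (_root_.triangleY G a b c).Adj p.1 p.2 → (_root_.triangleY G a b c).Adj q.1 q.2 →
      DisjE p q → optC o cr g p q + optC o cr g q p = o4 (optO o) p q := by
    rintro ⟨p1, p2⟩ ⟨q1, q2⟩ hp hq hd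
    dsimp only at hp hq
    have two : (2 : ZMod 2) = 0 := rfl
    cases p1 <;> cases p2 <;> cases q1 <;> cases q2 <;>
      first
      | exact absurd hp (SimpleGraph.irrefl _)
      | exact absurd hq (SimpleGraph.irrefl _)
      | exact absurd rfl hd.1
      | exact absurd rfl hd.2.1
      | exact absurd rfl hd.2.2.1
      | exact absurd rfl hd.2.2.2
      | skip
    · rename_i x s t
      have e1 := ht x s (fun e => hd.2.2.1 (by simp [e]))
      have e2 := ht x t (fun e => hd.2.2.2 (by simp [e]))
      simp only [optC, o4, optO] at *
      linear_combination e1 + e2 + (g (s, t) x + 0 - o x s - o x t) * two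
    · rename_i x s t
      have e1 := ht x s (fun e => hd.1 (by simp [e]))
      have e2 := ht x t (fun e => hd.2.1 (by simp [e]))
      simp only [optC, o4, optO] at *
      linear_combination e1 + e2 + (g (s, t) x - o x s - o x t) * two
    · rename_i u v x
      simp only [optC]
      linear_combination g (u, v) x * two
    · rename_i u v x
      simp only [optC]
      linear_combination g (u, v) x * two
    · rename_i u v x y
      simpa [o4, optO, optC] using hs (u, v) (x, y) (triangleY_some.mp hp).1
        (triangleY_some.mp hq).1 (by simpa [DisjE] using hd)
  have half : ∀ L M, EdgesIn (_root_.triangleY G a b c) L → EdgesIn (_root_.triangleY G a b c) M →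
      ClosedL L → ClosedL M → DisjL L M → (∀ p ∈ M, p.1 ≠ none ∧ p.2 ≠ none) →
      lk (optC o cr g) L M = 0 := by
    intro L M hL hM cL cM hd hn
    obtain ⟨M, rfl⟩ := map_some_of hn
    refine optC_lk hab hbc hac hl (h := h) (fun q hq => (hg q hq).1) (fun q hq => (hg q hq).2.1)
      (fun q hq => (hg q hq).2.2) L hL cL M ?_ ?_ hd
    · intro q hq
      exact (triangleY_some.mp (hM (some q.1, some q.2) (List.mem_map.mpr ⟨q, hq, rfl⟩))).1
    · intro k
      have := cM (fun x => x.elim 0 k)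
      rwa [bsum_map] at this
  refine ⟨optO o, optC o cr g, ?_, sym, ?_⟩
  · intro x y hxy
    cases x <;> cases y
    · exact absurd rfl hxy
    · simp [optO]
    · simp [optO]
    · exact ht _ _ (fun e => hxy (by simp [e]))
  · intro L M hL hM cL cM hd
    by_cases hn : ∀ p ∈ M, p.1 ≠ none ∧ p.2 ≠ none
    · exact half L M hL hM cL cM hd hn
    · rw [lk_symm_of sym hL hM cM hd]
      refine half M L hM hL cM cL hd.symm ?_
      push Not at hn
      obtain ⟨q, hq, hqn⟩ := hn
      intro p hp
      obtain ⟨d1, d2, d3, d4⟩ := hd p hp q hq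
      by_cases h1 : q.1 = none
      · rw [h1] at d1 d3
        exact ⟨d1, d3⟩
      · rw [hqn h1] at d2 d4
        exact ⟨d2, d4⟩

end deltaY

theorem petersen_not_flat {V : Type} {P : SimpleGraph V} (hP : IsPetersenFamily P) : ¬ Flat P := by
  induction hP with
  | k6 => exact not_flat_k6
  | deltaY _ _ _ _ ih => exact fun h => ih h.of_triangleY
  | yDelta _ h1 h2 h3 ih => exact fun h => ih (h.triangleY h1 h2 h3)
  | iso _ e ih => exact fun h => ih (h.iso e.symm)

theorem Flat.linkless {V : Type} {G : SimpleGraph V} (hG : Flat G) : IsLinkless G :=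
  fun _ _ hP hm => petersen_not_flat hP (hG.minor hm)

/-! ### Reduction of closed chains to simple cycles -/

/-- `l` is the vertex list of a path from `v` to `u` in `G`. -/
inductive PthL {V : Type} (G : SimpleGraph V) : V → V → List V → Prop
  | single (u : V) : PthL G u u [u]
  | cons {x v u : V} {l : List V} : G.Adj x v → PthL G v u l → x ∉ l → PthL G x u (x :: l)

/-- consecutive pairs -/
def prs {V : Type} : List V → List (V × V)
  | a :: b :: l => (a, b) :: prs (b :: l)
  | _ => []

theorem PthL.prs_cons {V : Type} {G : SimpleGraph V} {x v u : V} {l : List V}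
    (h : PthL G v u l) : prs (x :: l) = (x, v) :: prs l := by
  cases h <;> rfl

theorem PthL.head_mem {V : Type} {G : SimpleGraph V} {v u : V} {l : List V}
    (h : PthL G v u l) : v ∈ l := by
  cases h <;> simp

theorem PthL.last_mem {V : Type} {G : SimpleGraph V} {v u : V} {l : List V}
    (h : PthL G v u l) : u ∈ l := by
  induction h with
  | single => simp
  | cons _ _ _ ih => simp [ih]

theorem PthL.nodup {V : Type} {G : SimpleGraph V} {v u : V} {l : List V}
    (h : PthL G v u l) : l.Nodup := by
  induction h with
  | single => simp
  | cons _ _ h ih => simp [ih, h]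

theorem PthL.boundary {V : Type} {G : SimpleGraph V} {v u : V} {l : List V}
    (h : PthL G v u l) (k : V → ZMod 2) :
    bsum (prs l) (fun p => k p.1 + k p.2) = k v + k u := by
  induction h with
  | single => simp [prs, z2_add_self]
  | @cons x v u l hx hp hn ih =>
    rw [hp.prs_cons, bsum_cons, ih]
    simp only
    linear_combination z2_add_self (k v)

theorem PthL.prs_mem {V : Type} {G : SimpleGraph V} {v u : V} {l : List V}
    (h : PthL G v u l) : ∀ p ∈ prs l, G.Adj p.1 p.2 ∧ p.1 ∈ l ∧ p.2 ∈ l := by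
  induction h with
  | single => simp [prs]
  | @cons x v u l hx hp hn ih =>
    rw [hp.prs_cons]
    intro p hm
    rcases List.mem_cons.mp hm with rfl | hm
    · exact ⟨hx, by simp, by simp [hp.head_mem]⟩
    · obtain ⟨h1, h2, h3⟩ := ih p hm
      exact ⟨h1, by simp [h2], by simp [h3]⟩

/-- The closed chain of a simple cycle. -/
def cyE {V : Type} (u v : V) (l : List V) : List (V × V) := (u, v) :: prs l

theorem PthL.cyE_closed {V : Type} {G : SimpleGraph V} {v u : V} {l : List V}
    (h : PthL G v u l) : ClosedL (cyE u v l) := by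
  intro k
  rw [cyE, bsum_cons, h.boundary k]
  simp only
  linear_combination z2_add_self (k u) + z2_add_self (k v)

theorem PthL.cyE_edges {V : Type} {G : SimpleGraph V} {v u : V} {l : List V}
    (h : PthL G v u l) (huv : G.Adj u v) : EdgesIn G (cyE u v l) := by
  intro p hp
  rcases List.mem_cons.mp hp with rfl | hp
  · exact huv
  · exact (h.prs_mem p hp).1

theorem PthL.cyE_mem {V : Type} {G : SimpleGraph V} {v u : V} {l : List V}
    (h : PthL G v u l) : ∀ p ∈ cyE u v l, p.1 ∈ l ∧ p.2 ∈ l := by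
  intro p hp
  rcases List.mem_cons.mp hp with rfl | hp
  · exact ⟨h.last_mem, h.head_mem⟩
  · exact (h.prs_mem p hp).2

def wsum {V : Type} {G : SimpleGraph V} (t : V × V → ZMod 2) :
    ∀ {u v : V}, G.Walk u v → ZMod 2
  | _, _, .nil => 0
  | u, _, .cons (v := v) _ p => t (u, v) + wsum t p

theorem wsum_append {V : Type} {G : SimpleGraph V} (t : V × V → ZMod 2) {u v w : V}
    (p : G.Walk u v) (q : G.Walk v w) : wsum t (p.append q) = wsum t p + wsum t q := by
  induction p with
  | nil => simp [wsum]
  | cons h p ih => simp [wsum, ih, add_assoc]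

theorem wsum_reverse {V : Type} {G : SimpleGraph V} (t : V × V → ZMod 2)
    (ht : ∀ u v, G.Adj u v → t (u, v) = t (v, u)) {u v : V}
    (p : G.Walk u v) : wsum t p.reverse = wsum t p := by
  induction p with
  | nil => simp [wsum]
  | cons h p ih =>
    rw [SimpleGraph.Walk.reverse_cons, wsum_append, ih]
    simp [wsum, ht _ _ h, add_comm]

theorem wsum_bypass {V : Type} [DecidableEq V] {G : SimpleGraph V} (t : V × V → ZMod 2)
    (H : ∀ u v (_ : G.Adj u v) (w : G.Walk v u), w.IsPath → t (u, v) + wsum t w = 0)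
    {u v : V} (p : G.Walk u v) : wsum t p.bypass = wsum t p := by
  induction p with
  | nil => rfl
  | @cons u v w h p ih =>
    rw [SimpleGraph.Walk.bypass]
    split_ifs with hs
    · have e := wsum_append t (p.bypass.takeUntil u hs) (p.bypass.dropUntil u hs)
      rw [SimpleGraph.Walk.take_spec, ih] at e
      have e2 := H u v h (p.bypass.takeUntil u hs)
        (SimpleGraph.Walk.IsPath.takeUntil (SimpleGraph.Walk.bypass_isPath p) hs)
      simp only [wsum]
      rw [e]
      linear_combination -e2
    · simp only [wsum]
      rw [ih]

theorem wsum_closed {V : Type} {G : SimpleGraph V} (t : V × V → ZMod 2)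
    (H : ∀ u v (_ : G.Adj u v) (w : G.Walk v u), w.IsPath → t (u, v) + wsum t w = 0)
    {u : V} (p : G.Walk u u) : wsum t p = 0 := by
  classical
  rw [← wsum_bypass t H p]
  have := SimpleGraph.Walk.bypass_isPath p
  rw [SimpleGraph.Walk.isPath_iff_eq_nil] at this
  rw [this]; rfl

theorem walk_pth {V : Type} {G G' : SimpleGraph V} (hle : G' ≤ G) (t : V × V → ZMod 2) {u v : V}
    (p : G'.Walk u v) (hp : p.IsPath) :
    PthL G u v p.support ∧ wsum t p = bsum (prs p.support) t := by
  induction p with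
  | nil => exact ⟨PthL.single _, by simp [wsum, prs]⟩
  | cons h p ih =>
    rw [SimpleGraph.Walk.cons_isPath_iff] at hp
    obtain ⟨h1, h2⟩ := ih hp.1
    rw [SimpleGraph.Walk.support_cons]
    refine ⟨PthL.cons (hle h) h1 hp.2, ?_⟩
    rw [h1.prs_cons, bsum_cons, ← h2]; rfl

/-- A function vanishing on all simple cycles vanishes on all closed chains. -/
theorem vanish_of_cycles {V : Type} (G : SimpleGraph V) (A : V → Prop) (t : V × V → ZMod 2)
    (H : ∀ u v l, G.Adj u v → PthL G v u l → (∀ x ∈ l, A x) → bsum (cyE u v l) t = 0)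
    (L : List (V × V)) (hL : EdgesIn G L) (hA : ∀ p ∈ L, A p.1 ∧ A p.2) (cL : ClosedL L) :
    bsum L t = 0 := by
  let G' : SimpleGraph V :=
    { Adj := fun u v => G.Adj u v ∧ A u ∧ A v
      symm := ⟨fun u v h => ⟨h.1.symm, h.2.2, h.2.1⟩⟩
      loopless := ⟨fun u h => G.loopless.irrefl u h.1⟩ }
  have hle : G' ≤ G := fun u v h => h.1
  have hsup : ∀ {u v : V} (p : G'.Walk u v), A v → ∀ x ∈ p.support, A x := by
    intro u v p hv
    induction p with
    | nil => simpa using hv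
    | cons h p ih =>
      intro x hx
      rw [SimpleGraph.Walk.support_cons] at hx
      rcases List.mem_cons.mp hx with rfl | hx
      · exact h.2.1
      · exact ih hv x hx
  have H' : ∀ u v (_ : G'.Adj u v) (w : G'.Walk v u), w.IsPath → t (u, v) + wsum t w = 0 := by
    intro u v huv w hw
    obtain ⟨h1, h2⟩ := walk_pth hle t w hw
    rw [h2, ← H u v w.support huv.1 h1 (hsup w huv.2.1)]
    simp [cyE]
  have ht : ∀ u v, G'.Adj u v → t (u, v) = t (v, u) := by
    intro u v huv
    have := wsum_closed t H' (.cons huv (.cons huv.symm .nil))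
    simp only [wsum, add_zero] at this
    exact z2_eq_of_add this
  let r : V → V := fun v => (G'.connectedComponentMk v).out
  have hr : ∀ v, G'.Reachable (r v) v := fun v =>
    SimpleGraph.ConnectedComponent.exact (Quot.out_eq (G'.connectedComponentMk v))
  let w : ∀ v, G'.Walk (r v) v := fun v => (hr v).some
  let h : V → ZMod 2 := fun v => wsum t (w v)
  rw [← cL h]
  apply bsum_congr
  rintro ⟨u, v⟩ hp
  have huv : G'.Adj u v := ⟨hL _ hp, hA _ hp⟩
  have hrr : r v = r u := by
    have : G'.connectedComponentMk u = G'.connectedComponentMk v :=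
      SimpleGraph.ConnectedComponent.sound huv.reachable
    simp only [r, this]
  have key : ∀ (x : V) (e : x = r u) (q : G'.Walk x v), wsum t (w u) + t (u, v) + wsum t q = 0 := by
    rintro x rfl q
    have := wsum_closed t H' ((w u).append (.cons huv q.reverse))
    rw [wsum_append, wsum, wsum_reverse t ht] at this
    rw [← this, add_assoc]
  have := key (r v) hrr (w v)
  apply z2_eq_of_add
  simp only [h]
  rw [← this]; ring

/-! ### The circulant graph on 13 vertices -/

/-- adjacency of the circulant graph `C₁₃(1,3)` -/
def qadj (x y : Fin 13) : Bool :=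
  y - x == 1 || y - x == 3 || x - y == 1 || x - y == 3

def Q13 : SimpleGraph (Fin 13) where
  Adj x y := qadj x y = true
  symm := ⟨by intro x y h; simp only [qadj, Bool.or_eq_true] at h ⊢; tauto⟩
  loopless := ⟨by decide⟩

instance : DecidableRel Q13.Adj := fun x y => inferInstanceAs (Decidable (qadj x y = true))

/-- type and position of an edge -/
def qet (p : Fin 13 × Fin 13) : Bool × Fin 13 :=
  if p.2 - p.1 = 1 then (false, p.1) else if p.2 - p.1 = 3 then (true, p.1)
  else if p.1 - p.2 = 1 then (false, p.2) else (true, p.2)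

def qmask : Bool → Bool → ℕ
  | false, false => 128
  | false, true => 0
  | true, false => 576
  | true, true => 4436

def qcb (p q : Fin 13 × Fin 13) : Bool :=
  Nat.testBit (qmask (qet p).1 (qet q).1) ((qet q).2 - (qet p).2).val

def b2z (b : Bool) : ZMod 2 := if b then 1 else 0

theorem b2z_xor (a b : Bool) : b2z (xor a b) = b2z a + b2z b := by
  cases a <;> cases b <;> decide

def qc (p q : Fin 13 × Fin 13) : ZMod 2 := b2z (qcb p q)

def qob (x y : Fin 13) : Bool := decide (1 ≤ (y - x).val) && decide ((y - x).val ≤ 6)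

def qo (x y : Fin 13) : ZMod 2 := b2z (qob x y)

theorem qob_tour : ∀ x y, x ≠ y → xor (qob x y) (qob y x) = true := by decide +kernel

theorem qcb_sym : ∀ p1 p2, qadj p1 p2 = true → ∀ q1 q2, 
    (qadj q1 q2 && p1 != q1 && p1 != q2 && p2 != q1 && p2 != q2) = true →
    xor (qcb (p1, p2) (q1, q2)) (qcb (q1, q2) (p1, p2)) =
      xor (xor (xor (qob p1 q1) (qob p1 q2)) (qob p2 q1)) (qob p2 q2) := by decide +kernel

def qtab : List ℕ := [0, 4284, 2142, 7812, 1636, 7182, 1070, 4914, 1168, 908, 4681, 7040, 3640,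
  4388, 3564, 6411]

def xsum (f : Fin 13 × Fin 13 → Bool) : List (Fin 13 × Fin 13) → Bool
  | [] => false
  | p :: l => xor (f p) (xsum f l)

theorem b2z_xsum (f : Fin 13 × Fin 13 → Bool) (l : List (Fin 13 × Fin 13)) :
    b2z (xsum f l) = bsum l (fun p => b2z (f p)) := by
  induction l with
  | nil => rfl
  | cons p l ih => rw [xsum, b2z_xor, ih, bsum_cons]

def qver (m : ℕ) (E : List (Fin 13 × Fin 13)) (l : List (Fin 13)) : Bool :=
  (List.finRange 13).all fun x => l.elem x ||
    ([1, 3, 10, 12] : List (Fin 13)).all fun d => l.elem (x + d) ||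
      xsum (fun p => qcb p (x, x + d)) E == xor (m.testBit x.val) (m.testBit (x + d).val)

def qok (l : List (Fin 13)) : Bool :=
  !(qadj 0 (l.headD 0)) || qtab.any fun m => qver m (cyE 0 (l.headD 0) l) l

def qdfs : ℕ → List (Fin 13) → Bool
  | 0, _ => true
  | k + 1, l => qok l && ([1, 3, 10, 12] : List (Fin 13)).all fun d =>
      l.elem (l.headD 0 + d) || qdfs k ((l.headD 0 + d) :: l)

set_option maxRecDepth 100000 in
theorem qdfs_true : qdfs 6 [0] = true := by decide +kernel

theorem qdfs_step {k : ℕ} {l : List (Fin 13)} (h : qdfs (k + 1) l = true) :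
    qok l = true ∧ ∀ d ∈ ([1, 3, 10, 12] : List (Fin 13)), l.headD 0 + d ∉ l →
      qdfs k ((l.headD 0 + d) :: l) = true := by
  rw [qdfs, Bool.and_eq_true, List.all_eq_true] at h
  refine ⟨h.1, fun d hd hn => ?_⟩
  have := h.2 d hd
  rw [Bool.or_eq_true, List.elem_iff] at this
  exact this.resolve_left hn

theorem PthL.headD {v u d : Fin 13} {l : List (Fin 13)} {G : SimpleGraph (Fin 13)}
    (h : PthL G v u l) : l.headD d = v := by
  cases h <;> rfl

theorem qadj_diff : ∀ x v : Fin 13, qadj x v = true →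
    ∃ d ∈ ([1, 3, 10, 12] : List (Fin 13)), x = v + d := by decide +kernel

theorem qdfs_all {v u : Fin 13} {l : List (Fin 13)} (h : PthL Q13 v u l) (hu : u = 0) :
    l.length ≤ 6 → qdfs (7 - l.length) l = true := by
  induction h with
  | single u => subst hu; exact fun _ => qdfs_true
  | @cons x v u l hx hp hn ih =>
    intro hlen
    rw [List.length_cons] at hlen
    have h1 := ih hu (by omega)
    obtain ⟨k, hk⟩ : ∃ k, 7 - l.length = k + 1 := ⟨6 - l.length, by omega⟩
    rw [hk] at h1
    obtain ⟨d, hd, rfl⟩ := qadj_diff x v hx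
    have h2 := (qdfs_step h1).2 d hd
    rw [hp.headD] at h2
    have h3 := h2 hn
    rw [List.length_cons, show 7 - (l.length + 1) = k by omega]
    exact h3

theorem q_short0 {v : Fin 13} {l : List (Fin 13)} (h : PthL Q13 v 0 l) (hv : Q13.Adj 0 v)
    (hlen : l.length ≤ 6) : ∃ k : Fin 13 → ZMod 2, ∀ x y, Q13.Adj x y → x ∉ l → y ∉ l →
      bsum (cyE 0 v l) (fun p => qc p (x, y)) = k x + k y := by
  have h1 := qdfs_all h rfl hlen
  obtain ⟨j, hj⟩ : ∃ k, 7 - l.length = k + 1 := ⟨6 - l.length, by omega⟩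
  rw [hj] at h1
  have h2 := (qdfs_step h1).1
  rw [qok, h.headD, Bool.or_eq_true, List.any_eq_true] at h2
  have hv' : qadj 0 v = true := hv
  rw [hv'] at h2
  obtain ⟨m, _, hm⟩ := h2.resolve_left (by simp)
  refine ⟨fun x => b2z (m.testBit x.val), fun x y hxy hx hy => ?_⟩
  rw [qver, List.all_eq_true] at hm
  have h3 := hm x (List.mem_finRange x)
  rw [Bool.or_eq_true, List.elem_iff, List.all_eq_true] at h3
  obtain ⟨d, hd, rfl⟩ := qadj_diff y x hxy.symm
  have h4 := h3.resolve_left hx d hd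
  rw [Bool.or_eq_true, List.elem_iff] at h4
  have h5 := eq_of_beq (h4.resolve_left hy)
  simp only [qc]
  rw [← b2z_xsum, h5, b2z_xor]

theorem qadj_shift (s x y : Fin 13) : qadj (x + s) (y + s) = qadj x y := by
  simp only [qadj, add_sub_add_right_eq_sub]

theorem qcb_shift (s x y x' y' : Fin 13) :
    qcb (x + s, y + s) (x' + s, y' + s) = qcb (x, y) (x', y') := by
  have key : ∀ a b : Fin 13, qet (a + s, b + s) = ((qet (a, b)).1, (qet (a, b)).2 + s) := by
    intro a b
    simp only [qet, add_sub_add_right_eq_sub]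
    split_ifs <;> rfl
  simp only [qcb, key, add_sub_add_right_eq_sub]

theorem PthL.shift (s : Fin 13) {v u : Fin 13} {l : List (Fin 13)} (h : PthL Q13 v u l) :
    PthL Q13 (v + s) (u + s) (l.map (· + s)) := by
  induction h with
  | single u => exact PthL.single _
  | @cons x v u l hx hp hn ih =>
    refine PthL.cons ?_ ih ?_
    · exact (qadj_shift s x v).trans hx
    · simpa using hn

theorem prs_map {V W : Type} (f : V → W) (l : List V) :
    prs (l.map f) = (prs l).map (fun p => (f p.1, f p.2)) := by
  induction l with
  | nil => rfl
  | cons a l ih =>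
    cases l with
    | nil => rfl
    | cons b l => simp only [List.map_cons, prs] at ih ⊢; rw [ih]

theorem q_short {u v : Fin 13} {l : List (Fin 13)} (h : PthL Q13 v u l) (hv : Q13.Adj u v)
    (hlen : l.length ≤ 6) : ∃ k : Fin 13 → ZMod 2, ∀ x y, Q13.Adj x y → x ∉ l → y ∉ l →
      bsum (cyE u v l) (fun p => qc p (x, y)) = k x + k y := by
  have h' := h.shift (-u)
  rw [add_neg_cancel] at h'
  obtain ⟨k, hk⟩ := q_short0 h' (by
    have := (qadj_shift (-u) u v).trans hv
    rwa [add_neg_cancel] at this) (by simpa using hlen)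
  refine ⟨fun x => k (x + -u), fun x y hxy hx hy => ?_⟩
  rw [← hk (x + -u) (y + -u) ((qadj_shift (-u) x y).trans hxy) (by simpa using hx)
    (by simpa using hy)]
  have : cyE 0 (v + -u) (l.map (· + -u)) = (cyE u v l).map (fun p => (p.1 + -u, p.2 + -u)) := by
    simp only [cyE, List.map_cons, prs_map, add_neg_cancel]
  rw [this, bsum_map]
  apply bsum_congr
  rintro ⟨p1, p2⟩ _
  simp only [qc, qcb_shift]

theorem q_sym : ∀ p q, Q13.Adj p.1 p.2 → Q13.Adj q.1 q.2 → DisjE p q →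
    qc p q + qc q p = o4 qo p q := by
  rintro ⟨p1, p2⟩ ⟨q1, q2⟩ hp hq ⟨d1, d2, d3, d4⟩
  dsimp only at *
  have hq' : qadj q1 q2 = true := hq
  have := qcb_sym p1 p2 hp q1 q2 (by simp [hq', d1, d2, d3, d4])
  simp only [qc, o4, qo, ← b2z_xor, this]

theorem q_short_lk {u v : Fin 13} {l : List (Fin 13)} (h : PthL Q13 v u l) (hv : Q13.Adj u v)
    (hlen : l.length ≤ 6) (M : List (Fin 13 × Fin 13)) (hM : EdgesIn Q13 M) (cM : ClosedL M)
    (hd : ∀ q ∈ M, q.1 ∉ l ∧ q.2 ∉ l) : lk qc (cyE u v l) M = 0 := by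
  obtain ⟨k, hk⟩ := q_short h hv hlen
  rw [lk, bsum_comm, ← cM k]
  exact bsum_congr fun q hq => hk q.1 q.2 (hM q hq) (hd q hq).1 (hd q hq).2

theorem disjL_of {V : Type} {L M : List (V × V)} {A : V → Prop}
    (hL : ∀ p ∈ L, A p.1 ∧ A p.2) (hM : ∀ q ∈ M, ¬ A q.1 ∧ ¬ A q.2) : DisjL L M := by
  intro p hp q hq
  obtain ⟨a1, a2⟩ := hL p hp
  obtain ⟨b1, b2⟩ := hM q hq
  exact ⟨fun e => b1 (e ▸ a1), fun e => b2 (e ▸ a1), fun e => b1 (e ▸ a2), fun e => b2 (e ▸ a2)⟩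

theorem q_cyc_lk {u v u' v' : Fin 13} {l l' : List (Fin 13)} (h : PthL Q13 v u l)
    (hv : Q13.Adj u v) (h' : PthL Q13 v' u' l') (hv' : Q13.Adj u' v')
    (hd : ∀ x ∈ l', x ∉ l) : lk qc (cyE u v l) (cyE u' v' l') = 0 := by
  by_cases hlen : l.length ≤ 6
  · exact q_short_lk h hv hlen _ (h'.cyE_edges hv') h'.cyE_closed
      fun q hq => ⟨hd _ (h'.cyE_mem q hq).1, hd _ (h'.cyE_mem q hq).2⟩
  · have hnd : (l ++ l').Nodup := List.nodup_append'.mpr ⟨h.nodup, h'.nodup,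
      fun x hx hx' => hd x hx' hx⟩
    have := hnd.length_le_card
    rw [List.length_append, Fintype.card_fin] at this
    rw [lk_symm_of q_sym (h.cyE_edges hv) (h'.cyE_edges hv') h'.cyE_closed
      (disjL_of (A := fun x => x ∈ l) h.cyE_mem
        fun q hq => ⟨hd _ (h'.cyE_mem q hq).1, hd _ (h'.cyE_mem q hq).2⟩)]
    exact q_short_lk h' hv' (by omega) _ (h.cyE_edges hv) h.cyE_closed
      fun q hq => ⟨fun hx => hd _ hx (h.cyE_mem q hq).1, fun hx => hd _ hx (h.cyE_mem q hq).2⟩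

theorem q_flat : Flat Q13 := by
  refine ⟨qo, qc, ?_, q_sym, ?_⟩
  · intro x y hxy
    rw [qo, qo, ← b2z_xor, qob_tour x y hxy]; rfl
  · intro L M hL hM cL cM hd
    rw [lk]
    refine vanish_of_cycles Q13 (fun x => ∀ q ∈ M, x ≠ q.1 ∧ x ≠ q.2) _ ?_ L hL ?_ cL
    · intro u v l huv hl hA
      rw [bsum_comm]
      refine vanish_of_cycles Q13 (fun x => x ∉ l) _ ?_ M hM ?_ cM
      · intro u' v' l' huv' hl' hA'
        rw [bsum_comm]
        exact q_cyc_lk hl huv hl' huv' hA'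
      · exact fun q hq => ⟨fun h => (hA _ h q hq).1 rfl, fun h => (hA _ h q hq).2 rfl⟩
    · intro p hp
      exact ⟨fun q hq => ⟨(hd p hp q hq).1, (hd p hp q hq).2.1⟩,
        fun q hq => ⟨(hd p hp q hq).2.2.1, (hd p hp q hq).2.2.2⟩⟩

/-! ### Gluing two graphs along an edge -/

section glue
variable {V U : Type}

/-- Adjacency in the union of `G` and `H` where the edge between `inl true`, `inl false` of `H`
is identified with the edge `xy` of `G`. -/
def glueAdj (G : SimpleGraph V) (H : SimpleGraph (Bool ⊕ U)) (x y : V) : V ⊕ U → V ⊕ U → Prop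
  | .inl u, .inl v => G.Adj u v
  | .inr s, .inr t => H.Adj (.inr s) (.inr t)
  | .inl v, .inr s => (v = x ∧ H.Adj (.inl true) (.inr s)) ∨ (v = y ∧ H.Adj (.inl false) (.inr s))
  | .inr s, .inl v => (v = x ∧ H.Adj (.inl true) (.inr s)) ∨ (v = y ∧ H.Adj (.inl false) (.inr s))

def glue (G : SimpleGraph V) (H : SimpleGraph (Bool ⊕ U)) (x y : V) : SimpleGraph (V ⊕ U) where
  Adj := glueAdj G H x y
  symm := ⟨by
    rintro (u | s) (v | t) h
    · exact SimpleGraph.Adj.symm (G := G) h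
    · exact h
    · exact h
    · exact SimpleGraph.Adj.symm (G := H) h⟩
  loopless := ⟨by
    rintro (u | s) h
    · exact G.loopless.irrefl _ h
    · exact H.loopless.irrefl _ h⟩

/-- The inclusion of the vertices of `H` into the glued graph. -/
def inc (x y : V) : Bool ⊕ U → V ⊕ U
  | .inl true => .inl x
  | .inl false => .inl y
  | .inr s => .inr s

open Classical in
noncomputable def bk (x : V) : V ⊕ U → Bool ⊕ U
  | .inl v => if v = x then .inl true else .inl false
  | .inr s => .inr s

def pG : (V ⊕ U) × (V ⊕ U) → List (V × V)
  | (.inl u, .inl v) => [(u, v)]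
  | _ => []

noncomputable def pH (x : V) :
    (V ⊕ U) × (V ⊕ U) → List ((Bool ⊕ U) × (Bool ⊕ U))
  | (.inl _, .inl _) => []
  | p => [(bk x p.1, bk x p.2)]

theorem glue_cases {G : SimpleGraph V} {H : SimpleGraph (Bool ⊕ U)} {x y : V} (hxy : x ≠ y)
    (p : (V ⊕ U) × (V ⊕ U)) (hp : (glue G H x y).Adj p.1 p.2) :
    (∃ u v, G.Adj u v ∧ p = (.inl u, .inl v) ∧ pG p = [(u, v)] ∧ pH x p = []) ∨
    (∃ r s, H.Adj r s ∧ p = (inc x y r, inc x y s) ∧ pG p = [] ∧ pH x p = [(r, s)]) := by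
  obtain ⟨u | s, v | t⟩ := p
  · exact Or.inl ⟨u, v, hp, rfl, rfl, rfl⟩
  · right
    rcases hp with ⟨rfl, h⟩ | ⟨rfl, h⟩
    · exact ⟨_, _, h, rfl, rfl, by simp [pH, bk]⟩
    · exact ⟨_, _, h, rfl, rfl, by simp [pH, bk, hxy.symm]⟩
  · right
    rcases hp with ⟨rfl, h⟩ | ⟨rfl, h⟩
    · exact ⟨_, _, h.symm, rfl, rfl, by simp [pH, bk]⟩
    · exact ⟨_, _, h.symm, rfl, rfl, by simp [pH, bk, hxy.symm]⟩
  · right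
    exact ⟨_, _, hp, rfl, rfl, by simp [pH, bk]⟩

theorem exists_tour (X : Type) : ∃ o : X → X → ZMod 2, ∀ x y, x ≠ y → o x y + o y x = 1 := by
  classical
  refine ⟨fun x y => if WellOrderingRel x y then 1 else 0, fun x y hxy => ?_⟩
  rcases trichotomous_of WellOrderingRel x y with h1 | h1 | h1
  · have : ¬ WellOrderingRel y x := fun h => asymm h h1
    simp [h1, this]
  · exact absurd h1 hxy
  · have : ¬ WellOrderingRel x y := fun h => asymm h h1
    simp [h1, this]

/-- bilinear extension -/
def bil {A B : Type} (f : A → B → ZMod 2) (L : List A) (M : List B) : ZMod 2 :=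
  bsum L (fun p => bsum M (fun q => f p q))

theorem bil_flatMap {A B C D : Type} (f : C → D → ZMod 2) (φ : A → List C) (ψ : B → List D)
    (L : List A) (M : List B) :
    bsum L (fun p => bsum M (fun q => bil f (φ p) (ψ q))) = bil f (L.flatMap φ) (M.flatMap ψ) := by
  simp only [bil, bsum_flatMap]
  apply bsum_congr
  intro e _
  rw [bsum_comm]

theorem inc_inj {x y : V} (hxy : x ≠ y) : Function.Injective (inc (U := U) x y) := by
  rintro ((_ | _) | _) ((_ | _) | _) h <;> simp_all [inc]

open Classical in
noncomputable def ind {X : Type} (x : X) : X → ZMod 2 := fun y => if y = x then 1 else 0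

theorem Flat.glue {G : SimpleGraph V} {H : SimpleGraph (Bool ⊕ U)} {x y : V}
    (hxy : G.Adj x y) (hH : H.Adj (.inl true) (.inl false)) (fG : Flat G) (fH : Flat H) :
    Flat (glue G H x y) := by
  have nxy := hxy.ne
  obtain ⟨o, ht⟩ := exists_tour (V ⊕ U)
  obtain ⟨c1, -, hs1, hl1⟩ := fG.with (fun u v => o (.inl u) (.inl v))
    (fun u v huv => ht _ _ (by simpa using huv))
  obtain ⟨c2, -, hs2, hl2⟩ := fH.with (fun u v => o (inc x y u) (inc x y v))
    (fun u v huv => ht _ _ (fun e => huv (inc_inj nxy e)))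
  let m : (Bool ⊕ U) × (Bool ⊕ U) → V × V → ZMod 2 := fun p q =>
    (ind (.inl false) p.1 + ind (.inl false) p.2) * c1 (x, y) q
      + (ind y q.1 + ind y q.2) * c2 (.inl true, .inl false) p
  let oo : V × V → (Bool ⊕ U) × (Bool ⊕ U) → ZMod 2 := fun q p =>
    o4 o (.inl q.1, .inl q.2) (inc x y p.1, inc x y p.2)
  let m' : V × V → (Bool ⊕ U) × (Bool ⊕ U) → ZMod 2 := fun q p => m p q + oo q p
  let cc : (V ⊕ U) × (V ⊕ U) → (V ⊕ U) × (V ⊕ U) → ZMod 2 := fun p q =>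
    bil c1 (pG p) (pG q) + bil c2 (pH x p) (pH x q) + bil m (pH x p) (pG q)
      + bil m' (pG p) (pH x q)
  have sym : ∀ p q, (_root_.glue G H x y).Adj p.1 p.2 → (_root_.glue G H x y).Adj q.1 q.2 →
      DisjE p q → cc p q + cc q p = o4 o p q := by
    intro p q hp hq hd
    rcases glue_cases nxy p hp with ⟨u, v, huv, rfl, e1, e2⟩ | ⟨r, s, hrs, rfl, e1, e2⟩ <;>
    rcases glue_cases nxy q hq with ⟨u', v', huv', rfl, e1', e2'⟩ | ⟨r', s', hrs', rfl, e1', e2'⟩ <;>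
    simp only [cc, e1, e2, e1', e2', bil, bsum_cons, bsum_nil, add_zero, zero_add]
    · refine hs1 (u, v) (u', v') huv huv' ?_
      simpa [DisjE] using hd
    · simp only [m', oo]
      linear_combination z2_add_self (m (r', s') (u, v))
    · simp only [m', oo]
      have a1 := ht _ _ hd.1
      have a2 := ht _ _ hd.2.1
      have a3 := ht _ _ hd.2.2.1
      have a4 := ht _ _ hd.2.2.2
      have two : (2 : ZMod 2) = 0 := rfl
      simp only [o4] at *
      linear_combination z2_add_self (m (r, s) (u', v')) + a1 + a2 + a3 + a4 + (2 - (o (inc x y r) (Sum.inl u') +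
        o (inc x y r) (Sum.inl v') + o (inc x y s) (Sum.inl u') + o (inc x y s) (Sum.inl v'))) * two
    · refine hs2 (r, s) (r', s') hrs hrs' ?_
      obtain ⟨d1, d2, d3, d4⟩ := hd
      exact ⟨fun e => d1 (congrArg (inc x y) e), fun e => d2 (congrArg (inc x y) e), fun e => d3 (congrArg (inc x y) e),
        fun e => d4 (congrArg (inc x y) e)⟩
  -- parts of a list
  have bdy : ∀ L, EdgesIn (_root_.glue G H x y) L → ClosedL L → ∀ k : V ⊕ U → ZMod 2,
      bsum (L.flatMap pG) (fun p => k (.inl p.1) + k (.inl p.2)) +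
      bsum (L.flatMap (pH x)) (fun p => k (inc x y p.1) + k (inc x y p.2)) = 0 := by
    intro L hL cL k
    rw [bsum_flatMap, bsum_flatMap, ← bsum_add, ← cL k]
    apply bsum_congr
    intro p hp
    rcases glue_cases nxy p (hL p hp) with ⟨u, v, huv, rfl, e1, e2⟩ | ⟨r, s, hrs, rfl, e1, e2⟩ <;>
    simp [e1, e2]
  let ep : List ((V ⊕ U) × (V ⊕ U)) → ZMod 2 := fun L =>
    bsum (L.flatMap (pH x)) (fun p => ind (.inl false) p.1 + ind (.inl false) p.2)
  have bd2 : ∀ L, EdgesIn (_root_.glue G H x y) L → ClosedL L → ∀ k : Bool ⊕ U → ZMod 2,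
      bsum (L.flatMap (pH x)) (fun p => k p.1 + k p.2)
        = ep L * (k (.inl true) + k (.inl false)) := by
    intro L hL cL k
    have h := bdy L hL cL (fun z => z.elim (fun _ => k (.inl true)) (fun s => k (.inr s)))
    have h0 : bsum (L.flatMap pG) (fun p : V × V => (Sum.elim (fun _ : V => k (.inl true))
        (fun s : U => k (.inr s)) (.inl p.1)) + (Sum.elim (fun _ : V => k (.inl true))
        (fun s : U => k (.inr s)) (.inl p.2))) = 0 := by
      simp [z2_add_self]
    rw [h0, zero_add] at h
    rw [← add_zero (bsum _ _), ← h, ← bsum_add, ← bsum_mul']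
    apply bsum_congr
    rintro ⟨r, s⟩ _
    have key : ∀ r : Bool ⊕ U, k r + Sum.elim (fun _ : V => k (.inl true))
        (fun s : U => k (.inr s)) (inc x y r) = ind (.inl false) r * (k (.inl true) + k (.inl false)) := by
      rintro ((_ | _) | _)
      · simp [inc, ind]; ring
      · simp [inc, ind, z2_add_self]
      · simp [inc, ind, z2_add_self]
    simp only
    linear_combination key r + key s
  have bd1 : ∀ L, EdgesIn (_root_.glue G H x y) L → ClosedL L → ∀ k : V → ZMod 2,
      bsum (L.flatMap pG) (fun p => k p.1 + k p.2) = ep L * (k x + k y) := by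
    intro L hL cL k
    have h := bdy L hL cL (fun z => z.elim k (fun s => 0))
    have h' := bd2 L hL cL (fun r => (inc x y r).elim k (fun s => 0))
    rw [h'] at h
    exact z2_eq_of_add h
  have ed1 : ∀ L, EdgesIn (_root_.glue G H x y) L → EdgesIn G (L.flatMap pG) := by
    intro L hL p hp
    obtain ⟨e, he, hp⟩ := List.mem_flatMap.mp hp
    rcases glue_cases nxy e (hL e he) with ⟨u, v, huv, rfl, e1, e2⟩ | ⟨r, s, hrs, rfl, e1, e2⟩ <;>
    rw [e1] at hp
    · rw [List.mem_singleton] at hp; subst hp; exact huv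
    · simp at hp
  have ed2 : ∀ L, EdgesIn (_root_.glue G H x y) L → EdgesIn H (L.flatMap (pH x)) := by
    intro L hL p hp
    obtain ⟨e, he, hp⟩ := List.mem_flatMap.mp hp
    rcases glue_cases nxy e (hL e he) with ⟨u, v, huv, rfl, e1, e2⟩ | ⟨r, s, hrs, rfl, e1, e2⟩ <;>
    rw [e2] at hp
    · simp at hp
    · rw [List.mem_singleton] at hp; subst hp; exact hrs
  have mm1 : ∀ L, EdgesIn (_root_.glue G H x y) L → ∀ p ∈ L.flatMap pG,
      ((.inl p.1, .inl p.2) : (V ⊕ U) × (V ⊕ U)) ∈ L := by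
    intro L hL p hp
    obtain ⟨e, he, hp⟩ := List.mem_flatMap.mp hp
    rcases glue_cases nxy e (hL e he) with ⟨u, v, huv, rfl, e1, e2⟩ | ⟨r, s, hrs, rfl, e1, e2⟩ <;>
    rw [e1] at hp
    · rw [List.mem_singleton] at hp; subst hp; exact he
    · simp at hp
  have mm2 : ∀ L, EdgesIn (_root_.glue G H x y) L → ∀ p ∈ L.flatMap (pH x),
      ((inc x y p.1, inc x y p.2) : (V ⊕ U) × (V ⊕ U)) ∈ L := by
    intro L hL p hp
    obtain ⟨e, he, hp⟩ := List.mem_flatMap.mp hp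
    rcases glue_cases nxy e (hL e he) with ⟨u, v, huv, rfl, e1, e2⟩ | ⟨r, s, hrs, rfl, e1, e2⟩ <;>
    rw [e2] at hp
    · simp at hp
    · rw [List.mem_singleton] at hp; subst hp; exact he
  have lkcc : ∀ L M, EdgesIn (_root_.glue G H x y) M → ClosedL M →
      lk cc L M = lk c1 (L.flatMap pG) (M.flatMap pG) + lk c2 (L.flatMap (pH x)) (M.flatMap (pH x))
      + (ep L * bsum (M.flatMap pG) (fun q => c1 (x, y) q)
        + ep M * bsum (L.flatMap (pH x)) (fun p => c2 (.inl true, .inl false) p))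
      + (ep M * bsum (L.flatMap pG) (fun q => c1 (x, y) q)
        + bsum (L.flatMap pG) (fun q => ind y q.1 + ind y q.2)
          * bsum (M.flatMap (pH x)) (fun p => c2 (.inl true, .inl false) p))
      + bil oo (L.flatMap pG) (M.flatMap (pH x)) := by
    intro L M hM cM
    have e3 : bil m (L.flatMap (pH x)) (M.flatMap pG) = ep L * bsum (M.flatMap pG) (fun q => c1 (x, y) q)
        + ep M * bsum (L.flatMap (pH x)) (fun p => c2 (.inl true, .inl false) p) := by
      have hy := bd1 M hM cM (ind y)
      have : ind y x + ind y y = (1 : ZMod 2) := by simp [ind, nxy]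
      rw [this, mul_one] at hy
      simp only [bil, m, bsum_add, bsum_mul, bsum_mul', ep]
      simp only [ep, bsum_add] at hy
      rw [hy]
    have e4 : bil m' (L.flatMap pG) (M.flatMap (pH x)) = (ep M * bsum (L.flatMap pG) (fun q => c1 (x, y) q)
        + bsum (L.flatMap pG) (fun q => ind y q.1 + ind y q.2)
          * bsum (M.flatMap (pH x)) (fun p => c2 (.inl true, .inl false) p))
        + bil oo (L.flatMap pG) (M.flatMap (pH x)) := by
      simp only [bil, m', m, bsum_add, bsum_mul, bsum_mul', ep]
    rw [add_assoc _ _ (bil oo _ _), ← e4, ← e3]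
    simp only [lk, cc, bsum_add, bil_flatMap]
    rfl
  have z2 : ∀ z : ZMod 2, z = 0 ∨ z = 1 := by decide
  have half : ∀ L M, EdgesIn (_root_.glue G H x y) L → EdgesIn (_root_.glue G H x y) M → ClosedL L → ClosedL M →
      DisjL L M → ep M = 0 → lk cc L M = 0 := by
    intro L M hL hM cL cM hd eM
    have cM1 : ClosedL (M.flatMap pG) := fun k => by rw [bd1 M hM cM k, eM, zero_mul]
    have cM2 : ClosedL (M.flatMap (pH x)) := fun k => by rw [bd2 M hM cM k, eM, zero_mul]
    have eo : bil oo (L.flatMap pG) (M.flatMap (pH x)) = 0 := by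
      rw [← bsum_zero (L.flatMap pG)]
      apply bsum_congr
      intro q _
      rw [← cM2 (fun v => o (.inl q.1) (inc x y v) + o (.inl q.2) (inc x y v))]
      apply bsum_congr
      intro p _
      simp only [oo, o4]; ring
    have hyL := bd1 L hL cL (ind y)
    have : ind y x + ind y y = (1 : ZMod 2) := by simp [ind, nxy]
    rw [this, mul_one] at hyL
    rw [lkcc L M hM cM, eo, hyL, eM]
    have d1 : DisjL (L.flatMap pG) (M.flatMap pG) := by
      intro p hp q hq
      simpa [DisjE] using hd _ (mm1 L hL p hp) _ (mm1 M hM q hq)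
    have d2 : DisjL (L.flatMap (pH x)) (M.flatMap (pH x)) := by
      intro p hp q hq
      obtain ⟨d1, d2, d3, d4⟩ := hd _ (mm2 L hL p hp) _ (mm2 M hM q hq)
      exact ⟨fun e => d1 (congrArg (inc x y) e), fun e => d2 (congrArg (inc x y) e), fun e => d3 (congrArg (inc x y) e),
        fun e => d4 (congrArg (inc x y) e)⟩
    rcases z2 (ep L) with eL | eL
    · have cL1 : ClosedL (L.flatMap pG) := fun k => by rw [bd1 L hL cL k, eL, zero_mul]
      have cL2 : ClosedL (L.flatMap (pH x)) := fun k => by rw [bd2 L hL cL k, eL, zero_mul]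
      rw [hl1 _ _ (ed1 L hL) (ed1 M hM) cL1 cM1 d1, hl2 _ _ (ed2 L hL) (ed2 M hM) cL2 cM2 d2, eL]
      ring
    · have av : ∀ b : Bool, ∀ q ∈ M, inc x y (.inl b) ≠ q.1 ∧ inc x y (.inl b) ≠ q.2 := by
        intro b q hq
        have h1 := bd2 L hL cL (ind (.inl b))
        rw [eL] at h1
        have h2 : bsum (L.flatMap (pH x)) (fun p => ind (.inl b) p.1 + ind (.inl b) p.2) ≠ 0 := by
          rw [h1]; cases b <;> simp [ind]
        obtain ⟨p, hp, hpn⟩ := bsum_ne h2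
        have hpL := mm2 L hL p hp
        obtain ⟨d1, d2, d3, d4⟩ := hd _ hpL q hq
        by_cases hb : p.1 = .inl b
        · rw [← hb]; exact ⟨d1, d2⟩
        · by_cases hb' : p.2 = .inl b
          · rw [← hb']; exact ⟨d3, d4⟩
          · simp [ind, hb, hb'] at hpn
      have hlx := hl1 ((x, y) :: L.flatMap pG) (M.flatMap pG) (by
        intro p hp
        rcases List.mem_cons.mp hp with rfl | hp
        · exact hxy
        · exact ed1 L hL p hp) (ed1 M hM) (by
        intro k
        rw [bsum_cons, bd1 L hL cL k, eL, one_mul]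
        exact z2_add_self _) cM1 (by
        intro p hp q hq
        rcases List.mem_cons.mp hp with rfl | hp
        · have a1 := av true _ (mm1 M hM q hq)
          have a2 := av false _ (mm1 M hM q hq)
          simpa [DisjE, inc, and_assoc] using And.intro a1 a2
        · exact d1 p hp q hq)
      have hly := hl2 ((.inl true, .inl false) :: L.flatMap (pH x)) (M.flatMap (pH x)) (by
        intro p hp
        rcases List.mem_cons.mp hp with rfl | hp
        · exact hH
        · exact ed2 L hL p hp) (ed2 M hM) (by
        intro k
        rw [bsum_cons, bd2 L hL cL k, eL, one_mul]
        exact z2_add_self _) cM2 (by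
        intro p hp q hq
        rcases List.mem_cons.mp hp with rfl | hp
        · have a1 := av true _ (mm2 M hM q hq)
          have a2 := av false _ (mm2 M hM q hq)
          exact ⟨fun e => a1.1 (congrArg (inc x y) e), fun e => a1.2 (congrArg (inc x y) e),
            fun e => a2.1 (congrArg (inc x y) e), fun e => a2.2 (congrArg (inc x y) e)⟩
        · exact d2 p hp q hq)
      rw [lk, bsum_cons] at hlx hly
      rw [lk, lk, eL]
      linear_combination hlx + hly
  refine ⟨o, cc, ht, sym, ?_⟩
  intro L M hL hM cL cM hd
  rcases z2 (ep M) with eM | eM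
  · exact half L M hL hM cL cM hd eM
  · rw [lk_symm_of sym hL hM cM hd]
    refine half M L hM hL cM cL hd.symm ?_
    by_contra eL
    obtain ⟨p, hp, hpn⟩ := bsum_ne eL
    have eM' : ep M ≠ 0 := by rw [eM]; decide
    obtain ⟨q, hq, hqn⟩ := bsum_ne eM'
    obtain ⟨d1, d2, d3, d4⟩ := hd _ (mm2 L hL p hp) _ (mm2 M hM q hq)
    have e : ∀ r : (Bool ⊕ U) × (Bool ⊕ U), ind (.inl false) r.1 + ind (.inl false) r.2 ≠ (0 : ZMod 2) →
        r.1 = .inl false ∨ r.2 = .inl false := by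
      intro r hr
      by_contra hc
      push Not at hc
      simp [ind, hc.1, hc.2] at hr
    rcases e p hpn with h1 | h1 <;> rcases e q hqn with h2 | h2
    · exact d1 (by simp only [h1, h2])
    · exact d2 (by simp only [h1, h2])
    · exact d3 (by simp only [h1, h2])
    · exact d4 (by simp only [h1, h2])

end glue

/-! ### Minors -/

theorem reach_mono {V : Type} {G : SimpleGraph V} {S T : Set V} (hST : S ⊆ T)
    (hS : (G.induce S).Preconnected) {a b : V} (ha : a ∈ S) (hb : b ∈ S) :
    (G.induce T).Reachable ⟨a, hST ha⟩ ⟨b, hST hb⟩ :=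
  (hS ⟨a, ha⟩ ⟨b, hb⟩).map (SimpleGraph.induceHomOfLE G hST).toHom

theorem IsMinor.trans {W V X : Type} {P : SimpleGraph W} {G : SimpleGraph V} {K : SimpleGraph X}
    (h1 : IsMinor P G) (h2 : IsMinor G K) : IsMinor P K := by
  obtain ⟨f, fne, fc, fd, fa⟩ := h1
  obtain ⟨g, gne, gc, gd, ga⟩ := h2
  have gdis : ∀ u v x, x ∈ g u → x ∈ g v → u = v := by
    intro u v x hu hv
    by_contra huv
    exact Set.disjoint_left.mp (gd huv) hu hv
  have hmem : ∀ {w v x}, v ∈ f w → x ∈ g v → x ∈ ⋃ v ∈ f w, g v := by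
    intro w v x hv hx
    simp only [Set.mem_iUnion]
    exact ⟨v, hv, hx⟩
  have hsub : ∀ {w v}, v ∈ f w → g v ⊆ ⋃ v ∈ f w, g v := fun hv x hx => hmem hv hx
  refine ⟨fun w => ⋃ v ∈ f w, g v, ?_, ?_, ?_, ?_⟩
  · intro w
    obtain ⟨v, hv⟩ := fne w
    obtain ⟨x, hx⟩ := gne v
    exact ⟨x, hmem hv hx⟩
  · intro w
    obtain ⟨v0, hv0⟩ := fne w
    obtain ⟨x0, hx0⟩ := gne v0
    have : Nonempty ↑(⋃ v ∈ f w, g v) := ⟨⟨x0, hmem hv0 hx0⟩⟩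
    refine ⟨?_⟩
    have key : ∀ (v v' : f w) (p : (G.induce (f w)).Walk v v') (x y : X) (hx : x ∈ g v)
        (hy : y ∈ g v'), (K.induce (⋃ v ∈ f w, g v)).Reachable ⟨x, hmem v.2 hx⟩ ⟨y, hmem v'.2 hy⟩ := by
      intro v v' p
      induction p with
      | @nil u =>
        intro x y hx hy
        exact reach_mono (hsub u.2) (gc u).preconnected hx hy
      | @cons u v z h p ih =>
        intro x y hx hy
        obtain ⟨a, ha, b, hb, hab⟩ := ga (show G.Adj u v from h)
        have r1 := reach_mono (hsub u.2) (gc u).preconnected hx ha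
        have r2 := ih b y hb hy
        have r3 : (K.induce (⋃ v ∈ f w, g v)).Adj ⟨a, hmem u.2 ha⟩ ⟨b, hmem v.2 hb⟩ := hab
        exact (r1.trans r3.reachable).trans r2
    rintro ⟨x, hx⟩ ⟨y, hy⟩
    have hx' := hx
    have hy' := hy
    simp only [Set.mem_iUnion] at hx' hy'
    obtain ⟨v, hv, hxv⟩ := hx'
    obtain ⟨v', hv', hyv⟩ := hy'
    obtain ⟨p⟩ := (fc w).preconnected ⟨v, hv⟩ ⟨v', hv'⟩
    exact key _ _ p x y hxv hyv
  · intro w w' hw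
    rw [Set.disjoint_left]
    intro x hx hy
    simp only [Set.mem_iUnion] at hx hy
    obtain ⟨v, hv, hxv⟩ := hx
    obtain ⟨v', hv', hyv⟩ := hy
    obtain rfl := gdis v v' x hxv hyv
    exact Set.disjoint_left.mp (fd hw) hv hv'
  · intro w w' hw
    obtain ⟨v, hv, v', hv', hvv⟩ := fa hw
    obtain ⟨a, ha, b, hb, hab⟩ := ga hvv
    exact ⟨a, hmem hv ha, b, hmem hv' hb, hab⟩

theorem not_linkless_of_minor {V X : Type} {G : SimpleGraph V} {K : SimpleGraph X}
    (h : IsMinor G K) (hG : ¬ IsLinkless G) : ¬ IsLinkless K :=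
  fun hK => hG fun _ P hP hm => hK P hP (hm.trans h)

theorem minor_of_hom {V X : Type} {G : SimpleGraph V} {K : SimpleGraph X} (f : V → X)
    (hf : Function.Injective f) (ha : ∀ u v, G.Adj u v → K.Adj (f u) (f v)) : IsMinor G K := by
  refine ⟨fun v => {f v}, fun v => ⟨f v, rfl⟩, ?_, ?_, ?_⟩
  · intro v
    have : Nonempty ↑({f v} : Set X) := ⟨⟨f v, rfl⟩⟩
    refine ⟨?_⟩
    rintro ⟨x, rfl⟩ ⟨y, rfl⟩
    exact SimpleGraph.Reachable.refl _
  · intro u v huv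
    rw [Set.disjoint_singleton]
    exact fun e => huv (hf e)
  · intro u v huv
    exact ⟨f u, rfl, f v, rfl, ha u v huv⟩

theorem addEdge_adj {V : Type} {G : SimpleGraph V} {a b u v : V} :
    (addEdge G a b).Adj u v ↔ G.Adj u v ∨ (((u = a ∧ v = b) ∨ (u = b ∧ v = a)) ∧ u ≠ v) := by
  simp [addEdge]

theorem addEdge_comm {V : Type} (G : SimpleGraph V) (a b : V) : addEdge G a b = addEdge G b a := by
  ext u v
  rw [addEdge_adj, addEdge_adj, or_comm (a := u = a ∧ v = b)]

theorem addEdge_minor_of_hom {V X : Type} {G : SimpleGraph V} {K : SimpleGraph X} (f : V → X)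
    (hf : Function.Injective f) (ha : ∀ u v, G.Adj u v → K.Adj (f u) (f v)) (a b : V) :
    IsMinor (addEdge G a b) (addEdge K (f a) (f b)) := by
  refine minor_of_hom f hf ?_
  intro u v huv
  rw [addEdge_adj] at huv ⊢
  rcases huv with h | ⟨⟨rfl, rfl⟩ | ⟨rfl, rfl⟩, h⟩
  · exact Or.inl (ha u v h)
  · exact Or.inr ⟨Or.inl ⟨rfl, rfl⟩, fun e => h (hf e)⟩
  · exact Or.inr ⟨Or.inr ⟨rfl, rfl⟩, fun e => h (hf e)⟩

/-- Adding any missing edge destroys linkless embeddability. -/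
def EdgeMax {V : Type} (G : SimpleGraph V) : Prop :=
  ∀ a b : V, a ≠ b → ¬ G.Adj a b → ¬ IsLinkless (addEdge G a b)

theorem EdgeMax.iso {V X : Type} {G : SimpleGraph V} {K : SimpleGraph X} (e : G ≃g K)
    (h : EdgeMax G) : EdgeMax K := by
  intro a b hab hn
  have h1 := h (e.symm a) (e.symm b) (fun h => hab (e.symm.injective h))
    (fun h => hn (e.symm.map_adj_iff.mp h))
  have h2 := addEdge_minor_of_hom e e.injective (fun u v huv => e.map_adj_iff.mpr huv)
    (e.symm a) (e.symm b)
  simp only [RelIso.apply_symm_apply] at h2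
  exact not_linkless_of_minor h2 h1

theorem chain_connected {V : Type} {G : SimpleGraph V} (a : V) (l : List V)
    (h : List.IsChain G.Adj (a :: l)) : (G.induce {x | x ∈ a :: l}).Connected := by
  have key : ∀ (l : List V) (a : V), List.IsChain G.Adj (a :: l) → ∀ x (hx : x ∈ a :: l),
      (G.induce {x | x ∈ a :: l}).Reachable ⟨a, by simp⟩ ⟨x, hx⟩ := by
    intro l
    induction l with
    | nil =>
      intro a _ x hx
      rw [List.mem_singleton] at hx
      subst hx
      exact SimpleGraph.Reachable.refl _
    | cons b l ih =>
      intro a hc x hx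
      rw [List.isChain_cons_cons] at hc
      by_cases hxa : x = a
      · subst hxa
        exact SimpleGraph.Reachable.refl _
      · have hx' : x ∈ b :: l := (List.mem_cons.mp hx).resolve_left hxa
        have hsub : {x | x ∈ b :: l} ⊆ {x | x ∈ a :: b :: l} := fun y hy => List.mem_cons_of_mem a hy
        have r1 := (ih b hc.2 x hx').map (SimpleGraph.induceHomOfLE G hsub).toHom
        have r2 : (G.induce {x | x ∈ a :: b :: l}).Adj ⟨a, by simp⟩ ⟨b, by simp⟩ := hc.1
        exact r2.reachable.trans r1
  have : Nonempty ↑{x | x ∈ a :: l} := ⟨⟨a, by simp⟩⟩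
  refine ⟨?_⟩
  rintro ⟨x, hx⟩ ⟨y, hy⟩
  exact (key l a h x hx).symm.trans (key l a h y hy)

theorem k6_minor_of_lists {V : Type} {G : SimpleGraph V} (B : Fin 6 → List V)
    (h1 : ∀ i, B i ≠ []) (h2 : ∀ i, List.IsChain G.Adj (B i))
    (h3 : ∀ i j, i ≠ j → ∀ x ∈ B i, x ∉ B j)
    (h4 : ∀ i j, i ≠ j → ∃ x ∈ B i, ∃ y ∈ B j, G.Adj x y) : ¬ IsLinkless G := by
  refine fun h => h _ IsPetersenFamily.k6 ⟨fun i => {x | x ∈ B i}, ?_, ?_, ?_, ?_⟩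
  · intro i
    obtain ⟨a, l, e⟩ := List.exists_cons_of_ne_nil (h1 i)
    exact ⟨a, by simp [e]⟩
  · intro i
    obtain ⟨a, l, e⟩ := List.exists_cons_of_ne_nil (h1 i)
    have := h2 i
    show (G.induce {x | x ∈ B i}).Connected
    rw [e] at this ⊢
    exact chain_connected a l this
  · intro i j hij
    rw [Set.disjoint_left]
    exact fun x hx hy => h3 i j hij x hx hy
  · intro i j hij
    exact h4 i j hij

def qadd (d x y : Fin 13) : Bool := qadj x y || (x == 0 && y == d) || (x == d && y == 0)

theorem q_add_not_linkless (d : Fin 13) (hd : d ≠ 0) (B : Fin 6 → List (Fin 13))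
    (h1 : ∀ i, B i ≠ []) (h2 : ∀ i, List.IsChain (fun x y => qadd d x y = true) (B i))
    (h3 : ∀ i j, i ≠ j → ∀ x ∈ B i, x ∉ B j)
    (h4 : ∀ i j, i ≠ j → ∃ x ∈ B i, ∃ y ∈ B j, qadd d x y = true) :
    ¬ IsLinkless (addEdge Q13 0 d) := by
  have key : ∀ x y, qadd d x y = true → (addEdge Q13 0 d).Adj x y := by
    intro x y h
    rw [addEdge_adj]
    simp only [qadd, Bool.or_eq_true, Bool.and_eq_true, beq_iff_eq] at h
    rcases h with (h | ⟨rfl, rfl⟩) | ⟨rfl, rfl⟩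
    · exact Or.inl h
    · exact Or.inr ⟨Or.inl ⟨rfl, rfl⟩, hd.symm⟩
    · exact Or.inr ⟨Or.inr ⟨rfl, rfl⟩, hd⟩
  refine k6_minor_of_lists B h1 (fun i => (h2 i).imp key) h3 ?_
  intro i j hij
  obtain ⟨x, hx, y, hy, h⟩ := h4 i j hij
  exact ⟨x, hx, y, hy, key x y h⟩

theorem q_add2 : ¬ IsLinkless (addEdge Q13 0 2) :=
  q_add_not_linkless 2 (by decide) ![[1, 4], [9, 12, 11], [0, 10], [3, 6], [2, 5], [7, 8]]
    (by decide) (by decide +kernel) (by decide +kernel) (by decide +kernel)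

theorem q_add4 : ¬ IsLinkless (addEdge Q13 0 4) :=
  q_add_not_linkless 4 (by decide) ![[7, 10], [5, 8], [1, 11], [9, 12], [2, 3, 6], [0, 4]]
    (by decide) (by decide +kernel) (by decide +kernel) (by decide +kernel)

theorem q_add5 : ¬ IsLinkless (addEdge Q13 0 5) :=
  q_add_not_linkless 5 (by decide) ![[9, 8, 11], [1, 4], [12, 2, 3], [0, 10], [5], [6, 7]]
    (by decide) (by decide +kernel) (by decide +kernel) (by decide +kernel)

theorem q_add6 : ¬ IsLinkless (addEdge Q13 0 6) :=
  q_add_not_linkless 6 (by decide) ![[3, 4], [6], [7, 10], [0, 1], [5, 8, 11], [9, 12, 2]]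
    (by decide) (by decide +kernel) (by decide +kernel) (by decide +kernel)

theorem q_nonadj : ∀ a b : Fin 13, a ≠ b → qadj a b = false →
    (b - a ∈ ([2, 4, 5, 6] : List (Fin 13))) ∨ (a - b ∈ ([2, 4, 5, 6] : List (Fin 13))) := by
  decide +kernel

theorem q_edgeMax : EdgeMax Q13 := by
  have key : ∀ a b : Fin 13, b - a ∈ ([2, 4, 5, 6] : List (Fin 13)) →
      ¬ IsLinkless (addEdge Q13 a b) := by
    intro a b h
    have h1 := addEdge_minor_of_hom (G := Q13) (K := Q13) (fun x => x + a)
      (fun x y e => by simpa using e) (fun u v huv => (qadj_shift a u v).trans huv) 0 (b - a)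
    simp only [zero_add, sub_add_cancel] at h1
    refine not_linkless_of_minor h1 ?_
    simp only [List.mem_cons, List.not_mem_nil, or_false] at h
    rcases h with h | h | h | h <;> rw [h]
    · exact q_add2
    · exact q_add4
    · exact q_add5
    · exact q_add6
  intro a b hab hn
  rcases q_nonadj a b hab (by simpa using (show ¬ qadj a b = true from hn)) with h | h
  · exact key a b h
  · rw [addEdge_comm]
    exact key b a h

section glueMax
variable {V U : Type}

theorem inc_adj {G : SimpleGraph V} {H : SimpleGraph (Bool ⊕ U)} {x y : V} (hxy : G.Adj x y) :
    ∀ r s, H.Adj r s → (glue G H x y).Adj (inc x y r) (inc x y s) := by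
  rintro ((_ | _) | _) ((_ | _) | _) h
  · exact absurd h (SimpleGraph.irrefl _)
  · exact hxy.symm
  · exact Or.inr ⟨rfl, h⟩
  · exact hxy
  · exact absurd h (SimpleGraph.irrefl _)
  · exact Or.inl ⟨rfl, h⟩
  · exact Or.inr ⟨rfl, h.symm⟩
  · exact Or.inl ⟨rfl, h.symm⟩
  · exact h

theorem glue_contract {G : SimpleGraph V} {H : SimpleGraph (Bool ⊕ U)} {x y : V}
    (hxy : G.Adj x y) (b : Bool) (hc : (H.induce {z | z ≠ .inl (!b)}).Connected)
    (z : V) (hz : inc (U := U) x y (.inl b) = .inl z) (v : V) (hv : v ≠ z) (t : U) :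
    IsMinor (addEdge G z v) (addEdge (glue G H x y) (.inl v) (.inr t)) := by
  classical
  have hmemz : (.inl z : V ⊕ U) ∈ inc x y '' {w : Bool ⊕ U | w ≠ .inl (!b)} :=
    ⟨.inl b, by simp, hz⟩
  have hmemt : ∀ t, (.inr t : V ⊕ U) ∈ inc x y '' {w : Bool ⊕ U | w ≠ .inl (!b)} :=
    fun t => ⟨.inr t, by simp, rfl⟩
  have hmem : ∀ u, (.inl u : V ⊕ U) ∈ inc x y '' {w : Bool ⊕ U | w ≠ .inl (!b)} → u = z := by
    rintro u ⟨w, hw, e⟩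
    rcases w with c | s
    · have : c = b := by
        cases b <;> cases c <;> simp_all
      subst this
      rw [hz] at e
      exact (Sum.inl_injective e).symm
    · simp [inc] at e
  have c1 : ((addEdge (glue G H x y) (.inl v) (.inr t)).induce
      (inc x y '' {w | w ≠ .inl (!b)})).Connected := by
    have : Nonempty ↑(inc x y '' {w : Bool ⊕ U | w ≠ .inl (!b)}) := ⟨⟨_, hmemz⟩⟩
    refine ⟨?_⟩
    let φ : H.induce {w | w ≠ .inl (!b)} →g
        (addEdge (glue G H x y) (.inl v) (.inr t)).induce (inc x y '' {w | w ≠ .inl (!b)}) :=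
      { toFun := fun w => ⟨inc x y w.1, w.1, w.2, rfl⟩
        map_rel' := by
          intro r s hrs
          exact addEdge_adj.mpr (Or.inl (inc_adj hxy _ _ hrs)) }
    rintro ⟨_, r, hr, rfl⟩ ⟨_, s, hs, rfl⟩
    exact (hc.preconnected ⟨r, hr⟩ ⟨s, hs⟩).map φ
  have c2 : ∀ u, ((addEdge (glue G H x y) (.inl v) (.inr t)).induce
      ({.inl u} : Set (V ⊕ U))).Connected := by
    intro u
    have : Nonempty ↑({.inl u} : Set (V ⊕ U)) := ⟨⟨_, rfl⟩⟩
    refine ⟨?_⟩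
    rintro ⟨_, rfl⟩ ⟨_, rfl⟩
    exact SimpleGraph.Reachable.refl _
  have gen : ∀ S T : Set (V ⊕ U), S = T →
      ((addEdge (glue G H x y) (.inl v) (.inr t)).induce T).Connected →
      ((addEdge (glue G H x y) (.inl v) (.inr t)).induce S).Connected := by
    rintro S _ rfl h
    exact h
  refine ⟨fun u => if u = z then inc x y '' {w | w ≠ .inl (!b)} else {.inl u}, ?_, ?_, ?_, ?_⟩
  · intro u
    dsimp only
    split_ifs with h
    · exact ⟨_, hmemz⟩
    · exact ⟨_, rfl⟩
  · intro u
    by_cases h : u = z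
    · have e : (if u = z then inc x y '' {w | w ≠ .inl (!b)} else {.inl u} : Set (V ⊕ U)) =
        inc x y '' {w | w ≠ .inl (!b)} := if_pos h
      exact gen _ _ e c1
    · have e : (if u = z then inc x y '' {w | w ≠ .inl (!b)} else {.inl u} : Set (V ⊕ U)) =
        {.inl u} := if_neg h
      exact gen _ _ e (c2 u)
  · intro u w huw
    dsimp only
    rw [Set.disjoint_left]
    split_ifs with h1 h2 h2
    · exact absurd (h1.trans h2.symm) huw
    · rintro a ha rfl
      exact h2 (hmem w ha)
    · rintro a rfl ha
      exact h1 (hmem u ha)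
    · rintro a rfl ha
      exact huw (Sum.inl_injective ha)
  · have hin : ∀ u : V, (.inl u : V ⊕ U) ∈
        (if u = z then inc x y '' {w : Bool ⊕ U | w ≠ .inl (!b)} else {.inl u} : Set (V ⊕ U)) := by
      intro u
      split_ifs with h
      · rw [h]; exact hmemz
      · rfl
    intro u w huw
    rw [addEdge_adj] at huw
    rcases huw with h | ⟨⟨rfl, rfl⟩ | ⟨rfl, rfl⟩, h⟩
    · exact ⟨_, hin u, _, hin w, addEdge_adj.mpr (Or.inl h)⟩
    · refine ⟨.inr t, ?_, .inl w, hin w, addEdge_adj.mpr (Or.inr ⟨Or.inr ⟨rfl, rfl⟩, by simp⟩)⟩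
      simpa using hmemt t
    · refine ⟨.inl u, hin u, .inr t, ?_, addEdge_adj.mpr (Or.inr ⟨Or.inl ⟨rfl, rfl⟩, by simp⟩)⟩
      simpa using hmemt t

theorem glue_edgeMax {G : SimpleGraph V} {H : SimpleGraph (Bool ⊕ U)} {x y : V}
    (hxy : G.Adj x y) (hnt : ∀ v, ¬ (G.Adj x v ∧ G.Adj y v))
    (hc : ∀ b, (H.induce {z | z ≠ .inl b}).Connected)
    (mG : EdgeMax G) (mH : EdgeMax H) : EdgeMax (glue G H x y) := by
  have nxy := hxy.ne
  have viaH : ∀ r s, r ≠ s → ¬ H.Adj r s →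
      ¬ IsLinkless (addEdge (glue G H x y) (inc x y r) (inc x y s)) := fun r s hrs hn =>
    not_linkless_of_minor (addEdge_minor_of_hom _ (inc_inj nxy) (inc_adj hxy) r s) (mH r s hrs hn)
  have mixed : ∀ v t, ¬ (glue G H x y).Adj (.inl v) (.inr t) →
      ¬ IsLinkless (addEdge (glue G H x y) (.inl v) (.inr t)) := by
    intro v t hn
    by_cases hx : v = x
    · subst hx
      exact viaH (.inl true) (.inr t) (by simp) (fun h => hn (Or.inl ⟨rfl, h⟩))
    by_cases hy : v = y
    · subst hy
      exact viaH (.inl false) (.inr t) (by simp) (fun h => hn (Or.inr ⟨rfl, h⟩))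
    by_cases ha : G.Adj x v
    · have hb : ¬ G.Adj y v := fun h => hnt v ⟨ha, h⟩
      exact not_linkless_of_minor (glue_contract hxy false (hc _) y rfl v hy t)
        (mG y v (Ne.symm hy) hb)
    · exact not_linkless_of_minor (glue_contract hxy true (hc _) x rfl v hx t)
        (mG x v (Ne.symm hx) ha)
  rintro (u | s) (v | t) hne hn
  · exact not_linkless_of_minor (addEdge_minor_of_hom Sum.inl Sum.inl_injective
      (fun _ _ h => h) u v) (mG u v (fun e => hne (by rw [e])) hn)
  · exact mixed u t hn
  · rw [addEdge_comm]
    exact mixed v s (fun h => hn h.symm)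
  · exact viaH (.inr s) (.inr t) (fun e => hne (by simpa using e)) hn

end glueMax

/-! ### Counting and the final construction -/

/-- The graph of the edges that lie in no triangle. -/
def NT {V : Type} (G : SimpleGraph V) : SimpleGraph V where
  Adj u v := G.Adj u v ∧ ∀ w, ¬ (G.Adj u w ∧ G.Adj v w)
  symm := ⟨fun _ _ h => ⟨h.1.symm, fun w hw => h.2 w ⟨hw.2, hw.1⟩⟩⟩
  loopless := ⟨fun _ h => G.loopless.irrefl _ h.1⟩

section count
variable {V U : Type}

theorem nt_glue_left {G : SimpleGraph V} {H : SimpleGraph (Bool ⊕ U)} {x y u v : V}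
    (h : (NT G).Adj u v) (hne : s(u, v) ≠ s(x, y)) :
    (NT (glue G H x y)).Adj (.inl u) (.inl v) := by
  refine ⟨h.1, ?_⟩
  have huv := h.1.ne
  rintro (w | s) ⟨h1, h2⟩
  · exact h.2 w ⟨h1, h2⟩
  · rcases h1 with ⟨rfl, -⟩ | ⟨rfl, -⟩ <;> rcases h2 with ⟨rfl, -⟩ | ⟨rfl, -⟩
    · exact huv rfl
    · exact hne rfl
    · exact hne Sym2.eq_swap
    · exact huv rfl

theorem glue_adj_inr {G : SimpleGraph V} {H : SimpleGraph (Bool ⊕ U)} {x y : V} (hxy : x ≠ y)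
    (r : Bool ⊕ U) (s : U) (h : (glue G H x y).Adj (inc x y r) (.inr s)) : H.Adj r (.inr s) := by
  rcases r with (_ | _) | r
  · rcases h with ⟨e, h⟩ | ⟨e, h⟩
    · exact absurd e hxy.symm
    · exact h
  · rcases h with ⟨e, h⟩ | ⟨e, h⟩
    · exact h
    · exact absurd e hxy
  · exact h

theorem nt_glue_right {G : SimpleGraph V} {H : SimpleGraph (Bool ⊕ U)} {x y : V}
    (hx : (NT G).Adj x y) (hH : H.Adj (.inl true) (.inl false)) {r s : Bool ⊕ U}
    (h : (NT H).Adj r s) :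
    (NT (glue G H x y)).Adj (inc x y r) (inc x y s) := by
  have nxy := hx.1.ne
  refine ⟨inc_adj hx.1 _ _ h.1, ?_⟩
  rintro (w | w) ⟨h1, h2⟩
  · have key : ∀ t : U, (glue G H x y).Adj (.inr t) (.inl w) →
        (w = x ∧ H.Adj (.inl true) (.inr t)) ∨ (w = y ∧ H.Adj (.inl false) (.inr t)) :=
      fun t ht => ht
    have hw : ∀ b : Bool, inc (U := U) x y (.inl b) = .inl w →
        (glue G H x y).Adj (inc x y r) (inc x y (.inl b)) →
        (glue G H x y).Adj (inc x y s) (inc x y (.inl b)) → False := by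
      intro b hb h1 h2
      have rec1 : ∀ q : Bool ⊕ U, (glue G H x y).Adj (inc x y q) (inc x y (.inl b)) →
          H.Adj q (.inl b) := by
        rintro (c | q) hq
        · cases b <;> cases c
          · exact absurd hq (SimpleGraph.irrefl _)
          · exact hH
          · exact hH.symm
          · exact absurd hq (SimpleGraph.irrefl _)
        · exact (glue_adj_inr nxy (.inl b) q hq.symm).symm
      exact h.2 (.inl b) ⟨rec1 r h1, rec1 s h2⟩
    by_cases hwx : w = x
    · subst hwx
      exact hw true rfl h1 h2
    · by_cases hwy : w = y
      · subst hwy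
        exact hw false rfl h1 h2
      · have noinr : ∀ t : U, ¬ (glue G H x y).Adj (.inr t) (.inl w) := by
          intro t ht
          rcases key t ht with ⟨e, -⟩ | ⟨e, -⟩
          · exact hwx e
          · exact hwy e
        rcases r with (_ | _) | r
        · rcases s with (_ | _) | s
          · exact h.1.ne rfl
          · exact hx.2 w ⟨h2, h1⟩
          · exact noinr s h2
        · rcases s with (_ | _) | s
          · exact hx.2 w ⟨h1, h2⟩
          · exact h.1.ne rfl
          · exact noinr s h2
        · exact noinr r h1
  · exact h.2 (.inr w) ⟨glue_adj_inr nxy r w h1, glue_adj_inr nxy s w h2⟩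

theorem glue_count [Finite V] [Finite U] {x y : V} (hxy : x ≠ y) (A : Set (Sym2 V))
    (hA : s(x, y) ∈ A) (H : SimpleGraph (Bool ⊕ U)) :
    (Sym2.map Sum.inl '' (A \ {s(x, y)}) ∪ Sym2.map (inc x y) '' H.edgeSet :
      Set (Sym2 (V ⊕ U))).ncard = A.ncard - 1 + H.edgeSet.ncard := by
  have : Finite (Sym2 V) := inferInstance
  have : Finite (Sym2 (Bool ⊕ U)) := inferInstance
  rw [Set.ncard_union_eq, Set.ncard_image_of_injective _ (Sym2.map.injective Sum.inl_injective),
    Set.ncard_image_of_injective _ (Sym2.map.injective (inc_inj hxy)),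
    Set.ncard_sdiff_singleton_of_mem hA]
  · rw [Set.disjoint_left]
    rintro _ ⟨e, ⟨-, he⟩, rfl⟩ ⟨f, hf, hef⟩
    apply he
    rw [Set.mem_singleton_iff]
    induction e using Sym2.ind with | _ u v => ?_
    induction f using Sym2.ind with | _ r s => ?_
    have hne : r ≠ s := (show H.Adj r s from hf).ne
    rw [Sym2.map_mk, Sym2.map_mk, Sym2.eq_iff] at hef
    rcases r with (_ | _) | r <;> rcases s with (_ | _) | s <;>
      simp only [inc, reduceCtorEq, Sum.inl.injEq, false_and, and_false, or_self] at hef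
    · exact absurd rfl hne
    · rcases hef with ⟨rfl, rfl⟩ | ⟨rfl, rfl⟩
      · exact Sym2.eq_swap
      · rfl
    · rcases hef with ⟨rfl, rfl⟩ | ⟨rfl, rfl⟩
      · rfl
      · exact Sym2.eq_swap
    · exact absurd rfl hne

theorem glue_edges [Finite V] [Finite U] {G : SimpleGraph V} {H : SimpleGraph (Bool ⊕ U)} {x y : V}
    (hxy : G.Adj x y) (hH : H.Adj (.inl true) (.inl false)) :
    (glue G H x y).edgeSet.ncard = G.edgeSet.ncard - 1 + H.edgeSet.ncard := by
  rw [← glue_count hxy.ne G.edgeSet hxy H]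
  congr 1
  ext e
  induction e using Sym2.ind with | _ a b => ?_
  constructor
  · intro h
    rcases glue_cases hxy.ne (a, b) h with ⟨u, v, huv, e, -⟩ | ⟨r, s, hrs, e, -⟩
    · obtain ⟨rfl, rfl⟩ := Prod.mk.inj e
      by_cases he : s(u, v) = s(x, y)
      · right
        refine ⟨s(.inl true, .inl false), hH, ?_⟩
        have := congrArg (Sym2.map (Sum.inl : V → V ⊕ U)) he
        exact this.symm
      · exact Or.inl ⟨s(u, v), ⟨huv, he⟩, rfl⟩
    · obtain ⟨rfl, rfl⟩ := Prod.mk.inj e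
      exact Or.inr ⟨s(r, s), hrs, rfl⟩
  · rintro (⟨f, ⟨hf, -⟩, e⟩ | ⟨f, hf, e⟩)
    · induction f using Sym2.ind with | _ u v => ?_
      rw [← e]
      exact hf
    · induction f using Sym2.ind with | _ u v => ?_
      rw [← e]
      exact inc_adj hxy _ _ hf

theorem nt_edges [Finite V] [Finite U] {G : SimpleGraph V} {H : SimpleGraph (Bool ⊕ U)} {x y : V}
    (hxy : (NT G).Adj x y) (hH : H.Adj (.inl true) (.inl false)) :
    (NT G).edgeSet.ncard - 1 + (NT H).edgeSet.ncard ≤ (NT (glue G H x y)).edgeSet.ncard := by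
  rw [← glue_count hxy.1.ne (NT G).edgeSet hxy (NT H)]
  refine Set.ncard_le_ncard ?_ (Set.toFinite _)
  rintro _ (⟨f, ⟨hf, hne⟩, rfl⟩ | ⟨f, hf, rfl⟩)
  · induction f using Sym2.ind with | _ u v => ?_
    exact nt_glue_left hf hne
  · induction f using Sym2.ind with | _ u v => ?_
    exact nt_glue_right hxy hH hf

end count

/-- There is a suitable graph with `n` vertices, `m` edges and at least `t` edges
in no triangle. -/
def Good (n m t : ℕ) : Prop :=
  ∃ (V : Type) (_ : Finite V) (G : SimpleGraph V), Flat G ∧ EdgeMax G ∧ Nat.card V = n ∧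
    G.edgeSet.ncard = m ∧ t ≤ (NT G).edgeSet.ncard

theorem Good.glue {n m t : ℕ} (h : Good n m t) (ht : 1 ≤ t) {U : Type} [Finite U]
    {H : SimpleGraph (Bool ⊕ U)} (hH : H.Adj (.inl true) (.inl false)) (fH : Flat H)
    (mH : EdgeMax H) (hc : ∀ b, (H.induce {z | z ≠ .inl b}).Connected) :
    Good (n + Nat.card U) (m - 1 + H.edgeSet.ncard) (t - 1 + (NT H).edgeSet.ncard) := by
  obtain ⟨V, _, G, fG, mG, rfl, rfl, htG⟩ := h
  have hpos : 0 < (NT G).edgeSet.ncard := by omega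
  obtain ⟨e, he⟩ := Set.nonempty_of_ncard_ne_zero hpos.ne'
  induction e using Sym2.ind with | _ x y => ?_
  have hxy : (NT G).Adj x y := he
  refine ⟨V ⊕ U, inferInstance, _root_.glue G H x y, fG.glue hxy.1 hH fH,
    glue_edgeMax hxy.1 hxy.2 hc mG mH, Nat.card_sum, glue_edges hxy.1 hH, ?_⟩
  refine le_trans ?_ (nt_edges hxy hH)
  omega

theorem k3_flat : Flat (⊤ : SimpleGraph (Bool ⊕ Unit)) := by
  have key : ∀ a b c d : Bool ⊕ Unit, a ≠ b → c ≠ d →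
      ¬ (a ≠ c ∧ a ≠ d ∧ b ≠ c ∧ b ≠ d) := by decide
  obtain ⟨o, ho⟩ := exists_tour (Bool ⊕ Unit)
  refine ⟨o, fun _ _ => 0, ho, ?_, ?_⟩
  · intro p q hp hq hd
    exact absurd hd (key p.1 p.2 q.1 q.2 hp hq)
  · intro L M _ _ _ _ _
    simp [lk]

theorem k3_edgeMax : EdgeMax (⊤ : SimpleGraph (Bool ⊕ Unit)) :=
  fun _ _ hab hn => absurd hab hn

theorem k3_edges : (⊤ : SimpleGraph (Bool ⊕ Unit)).edgeSet.ncard = 3 := by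
  rw [← SimpleGraph.coe_edgeFinset, Set.ncard_coe_finset]
  decide

theorem conn_of_list {V : Type} [DecidableEq V] {G : SimpleGraph V} (S : Set V) (a : V) (l : List V)
    (h : List.IsChain G.Adj (a :: l)) (hS : ∀ x, x ∈ S ↔ (a :: l).any (fun y => decide (x = y)) = true) :
    (G.induce S).Connected := by
  obtain rfl : S = {x | x ∈ a :: l} := Set.ext fun x => by rw [hS]; simp
  exact chain_connected a l h

theorem k3_conn (b : Bool) :
    ((⊤ : SimpleGraph (Bool ⊕ Unit)).induce {z | z ≠ .inl b}).Connected := by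
  refine conn_of_list _ (.inl (!b)) [.inr ()] ?_ ?_
  · simp
  · intro x
    show x ≠ _ ↔ _
    revert x b
    decide

theorem Good.k3 {n m t : ℕ} (h : Good n m (t + 1)) : Good (n + 1) (m - 1 + 3) t := by
  obtain ⟨V, i, G, h1, h2, h3, h4, h5⟩ := h.glue (by omega) (U := Unit) (H := ⊤) (by simp)
    k3_flat k3_edgeMax k3_conn
  refine ⟨V, i, G, h1, h2, ?_, ?_, by omega⟩
  · simpa using h3
  · rw [h4, k3_edges]

theorem nt_q_adj : ∀ u v : Fin 13, qadj u v = true → ∀ w, ¬ (qadj u w = true ∧ qadj v w = true) := by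
  decide +kernel

theorem q_edges : Q13.edgeSet.ncard = 26 := by
  rw [← SimpleGraph.coe_edgeFinset, Set.ncard_coe_finset]
  decide +kernel

theorem nt_q : NT Q13 = Q13 := by
  ext u v
  exact ⟨fun h => h.1, fun h => ⟨h, nt_q_adj u v h⟩⟩

theorem good_start : Good 13 26 26 :=
  ⟨Fin 13, inferInstance, Q13, q_flat, q_edgeMax, by simp, q_edges, by rw [nt_q, q_edges]⟩

def qfun : Bool ⊕ Fin 11 → Fin 13
  | .inl true => 0
  | .inl false => 1
  | .inr i => ⟨i.val + 2, by omega⟩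

theorem qfun_inj : Function.Injective qfun := by decide +kernel

theorem qfun_bij : Function.Bijective qfun :=
  (Fintype.bijective_iff_injective_and_card _).mpr ⟨qfun_inj, by simp⟩

def HQ : SimpleGraph (Bool ⊕ Fin 11) := Q13.comap qfun

noncomputable def hqIso : HQ ≃g Q13 := SimpleGraph.Iso.comap (Equiv.ofBijective qfun qfun_bij) Q13

theorem iso_edges {V W : Type} {G : SimpleGraph V} {H : SimpleGraph W} (e : G ≃g H) :
    G.edgeSet.ncard = H.edgeSet.ncard :=
  Nat.card_congr e.mapEdgeSet

theorem nt_hq : NT HQ = HQ := by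
  ext u v
  exact ⟨fun h => h.1, fun h => ⟨h, fun w hw => nt_q_adj (qfun u) (qfun v) h (qfun w) hw⟩⟩

theorem hq_conn (b : Bool) : (HQ.induce {z | z ≠ .inl b}).Connected := by
  have hdec : ∀ l : List (Bool ⊕ Fin 11),
      List.IsChain (fun r s => qadj (qfun r) (qfun s) = true) l → List.IsChain HQ.Adj l :=
    fun l h => h
  cases b
  · refine conn_of_list _ (.inr 0) [.inr 1, .inr 2, .inr 3, .inr 4, .inr 5, .inr 6, .inr 7, .inr 8,
      .inr 9, .inr 10, .inl true] (hdec _ (by decide +kernel)) ?_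
    intro x
    show x ≠ _ ↔ _
    revert x
    decide +kernel
  · refine conn_of_list _ (.inl false) [.inr 0, .inr 1, .inr 2, .inr 3, .inr 4, .inr 5, .inr 6,
      .inr 7, .inr 8, .inr 9, .inr 10] (hdec _ (by decide +kernel)) ?_
    intro x
    show x ≠ _ ↔ _
    revert x
    decide +kernel

theorem Good.q {n m t : ℕ} (h : Good n m (t + 1)) : Good (n + 11) (m - 1 + 26) (t + 26) := by
  obtain ⟨V, i, G, h1, h2, h3, h4, h5⟩ := h.glue (by omega) (U := Fin 11) (H := HQ)
    (show qadj 0 1 = true by decide) (q_flat.iso hqIso.symm) (q_edgeMax.iso hqIso.symm) hq_conn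
  have hE : HQ.edgeSet.ncard = 26 := (iso_edges hqIso).trans q_edges
  rw [hE] at h4
  rw [nt_hq, hE] at h5
  refine ⟨V, i, G, h1, h2, ?_, h4, by omega⟩
  simpa using h3

theorem good_q (i : ℕ) : Good (13 + 11 * i) (26 + 25 * i) (26 + 25 * i) := by
  induction i with
  | zero => exact good_start
  | succ i ih =>
    have := Good.q (t := 25 + 25 * i) (by convert ih using 1; omega)
    convert this using 1 <;> omega

theorem good_k (i k : ℕ) : ∀ t, k + t = 26 + 25 * i →
    Good (13 + 11 * i + k) (26 + 25 * i + 2 * k) t := by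
  induction k with
  | zero =>
    intro t ht
    obtain rfl : t = 26 + 25 * i := by omega
    exact good_q i
  | succ k ih =>
    intro t ht
    have := (ih (t + 1) (by omega)).k3
    have e : 26 + 25 * i + 2 * (k + 1) = 26 + 25 * i + 2 * k - 1 + 3 := by omega
    rw [e]
    exact this

theorem final_graph (n : ℕ) (hn : 13 ≤ n) :
    ∃ m t, Good n m t ∧ 12 * m + 3 < 25 * n := by
  have h1 : n = 13 + 11 * ((n - 4) / 36) + (n - 13 - 11 * ((n - 4) / 36)) := by omega
  refine ⟨26 + 25 * ((n - 4) / 36) + 2 * (n - 13 - 11 * ((n - 4) / 36)),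
    26 + 25 * ((n - 4) / 36) - (n - 13 - 11 * ((n - 4) / 36)), ?_, by omega⟩
  have := good_k ((n - 4) / 36) (n - 13 - 11 * ((n - 4) / 36))
    (26 + 25 * ((n - 4) / 36) - (n - 13 - 11 * ((n - 4) / 36))) (by omega)
  rwa [← h1] at this

/-- For every `n ≥ 13` there exists a maxnil graph with `n` vertices and `m` edges,
where `m < 25n/12 - 1/4`. -/
theorem stmt_0 (n : ℕ) (hn : 13 ≤ n) :
    ∃ (G : SimpleGraph (Fin n)) (m : ℕ),
      IsMaxnil G ∧ G.edgeSet.ncard = m ∧ (m : ℚ) < 25 * n / 12 - 1 / 4 := by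
  obtain ⟨m, t, ⟨V, _, G, fG, mG, hV, hm, -⟩, hlt⟩ := final_graph n hn
  have e : V ≃ Fin n := Finite.equivFinOfCardEq hV
  let f : G ≃g G.map e.toEmbedding := SimpleGraph.Iso.map e G
  refine ⟨G.map e.toEmbedding, m, ⟨(fG.iso f).linkless, ?_⟩, (iso_edges f).symm.trans hm, ?_⟩
  · exact mG.iso f
  · have : ((12 * m + 3 : ℕ) : ℚ) < ((25 * n : ℕ) : ℚ) := by exact_mod_cast hlt
    push_cast at this
    linarith
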